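/- Given a finite Kripke structure M and a PLTL formula ψ, M ⊨ ψ if and only if for some k ≥ 0 the formula ⟦⟦M,¬ψ,k⟧⟧ ∧ ⟦SimplePath⟧_k is unsatisfiable and either k = 0 or ⟦M,¬ψ,k−1⟧ is unsatisfiable. -/

import Mathlib

namespace BMC

/-- PLTL formulas in positive normal form: literals `p`, `¬p`, conjunction,
disjunction, next `X`, until `U`, release `R`, previous `Y`, weak previous `Z`,
since `S` and trigger `T`. -/
inductive PLTL (AP : Type) : Type
  | atom  : AP → PLTL AP
  | natom : AP → PLTL AP
  | conj  : PLTL AP → PLTL AP → PLTL AP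
  | disj  : PLTL AP → PLTL AP → PLTL AP
  | next  : PLTL AP → PLTL AP
  | untl  : PLTL AP → PLTL AP → PLTL AP
  | rels  : PLTL AP → PLTL AP → PLTL AP
  | prev  : PLTL AP → PLTL AP
  | wprev : PLTL AP → PLTL AP
  | since : PLTL AP → PLTL AP → PLTL AP
  | trig  : PLTL AP → PLTL AP → PLTL AP

variable {AP S : Type}

/-- Standard PLTL semantics `π^i ⊨ φ` on an infinite sequence of states `π`
with labelling `L`. -/
def PLTL.sat (L : S → Set AP) (π : ℕ → S) : PLTL AP → ℕ → Prop
  | .atom p, i => p ∈ L (π i)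
  | .natom p, i => p ∉ L (π i)
  | .conj f g, i => PLTL.sat L π f i ∧ PLTL.sat L π g i
  | .disj f g, i => PLTL.sat L π f i ∨ PLTL.sat L π g i
  | .next f, i => PLTL.sat L π f (i + 1)
  | .untl f g, i => ∃ j, i ≤ j ∧ PLTL.sat L π g j ∧ ∀ n, i ≤ n → n < j → PLTL.sat L π f n
  | .rels f g, i => ∀ j, i ≤ j → (PLTL.sat L π g j ∨ ∃ n, i ≤ n ∧ n < j ∧ PLTL.sat L π f n)
  | .prev f, i => 0 < i ∧ PLTL.sat L π f (i - 1)
  | .wprev f, i => i = 0 ∨ PLTL.sat L π f (i - 1)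
  | .since f g, i => ∃ j, j ≤ i ∧ PLTL.sat L π g j ∧ ∀ n, j < n → n ≤ i → PLTL.sat L π f n
  | .trig f g, i => ∀ j, j ≤ i → (PLTL.sat L π g j ∨ ∃ n, j < n ∧ n ≤ i ∧ PLTL.sat L π f n)

/-- The no-loop bounded semantics `π^i ⊨_nl φ` with bound `k`: future operators
are restricted to positions `≤ k`. -/
def PLTL.satNL (L : S → Set AP) (π : ℕ → S) (k : ℕ) : PLTL AP → ℕ → Prop
  | .atom p, i => p ∈ L (π i)
  | .natom p, i => p ∉ L (π i)
  | .conj f g, i => PLTL.satNL L π k f i ∧ PLTL.satNL L π k g i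
  | .disj f g, i => PLTL.satNL L π k f i ∨ PLTL.satNL L π k g i
  | .next f, i => i < k ∧ PLTL.satNL L π k f (i + 1)
  | .untl f g, i => ∃ j, i ≤ j ∧ j ≤ k ∧ PLTL.satNL L π k g j ∧
      ∀ n, i ≤ n → n < j → PLTL.satNL L π k f n
  | .rels f g, i => ∃ j, i ≤ j ∧ j ≤ k ∧ PLTL.satNL L π k f j ∧
      ∀ n, i ≤ n → n ≤ j → PLTL.satNL L π k g n
  | .prev f, i => 0 < i ∧ PLTL.satNL L π k f (i - 1)
  | .wprev f, i => i = 0 ∨ PLTL.satNL L π k f (i - 1)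
  | .since f g, i => ∃ j, j ≤ i ∧ PLTL.satNL L π k g j ∧
      ∀ n, j < n → n ≤ i → PLTL.satNL L π k f n
  | .trig f g, i => ∀ j, j ≤ i → (PLTL.satNL L π k g j ∨
      ∃ n, j < n ∧ n ≤ i ∧ PLTL.satNL L π k f n)

/-- `π` is a (k,l)-loop: `0 < l ≤ k`, `π (l-1) = π k`, and from position `l`
onwards `π` is periodic with period `p = k + 1 - l`. -/
def IsKLoop (π : ℕ → S) (k l : ℕ) : Prop :=
  0 < l ∧ l ≤ k ∧ π (l - 1) = π k ∧ ∀ i, l ≤ i → π (i + (k + 1 - l)) = π i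

/-- The bounded semantics `π ⊨_k φ`. -/
def PLTL.bsat (L : S → Set AP) (π : ℕ → S) (k : ℕ) (φ : PLTL AP) : Prop :=
  (∃ l, IsKLoop π k l ∧ PLTL.sat L π φ 0) ∨ PLTL.satNL L π k φ 0

/-- The past operator depth `δ`. -/
def PLTL.delta : PLTL AP → ℕ
  | .atom _ => 0
  | .natom _ => 0
  | .conj f g => max f.delta g.delta
  | .disj f g => max f.delta g.delta
  | .next f => f.delta
  | .untl f g => max f.delta g.delta
  | .rels f g => max f.delta g.delta
  | .prev f => f.delta + 1
  | .wprev f => f.delta + 1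
  | .since f g => max f.delta g.delta + 1
  | .trig f g => max f.delta g.delta + 1

/-- A Kripke structure over state space `S` and atomic propositions `AP`. -/
structure Kripke (S AP : Type) where
  T : S → S → Prop
  I : S → Prop
  L : S → Set AP

/-- The transition relation is total. -/
def Kripke.Total (M : Kripke S AP) : Prop := ∀ s, ∃ s', M.T s s'

/-- An initialised infinite path of `M`. -/
def Kripke.InitPath (M : Kripke S AP) (π : ℕ → S) : Prop :=
  M.I (π 0) ∧ ∀ i, M.T (π i) (π (i + 1))

end BMC
namespace BMC

variable {AP S : Type}

/-- Model constraints `⟦M⟧_k = I(s_0) ∧ ⋀_{i=1}^k T(s_{i-1}, s_i)`. -/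
def ModelC (M : Kripke S AP) (k : ℕ) (s : ℕ → S) : Prop :=
  M.I (s 0) ∧ ∀ i, 1 ≤ i → i ≤ k → M.T (s (i - 1)) (s i)

/-- Loop constraints `⟦LoopConstraints⟧_k`. -/
def LoopC (k : ℕ) (s : ℕ → S) (lsel inL : ℕ → Prop) (LE : Prop) : Prop :=
  ¬ lsel 0 ∧ ¬ inL 0 ∧
  (∀ i, 1 ≤ i → i ≤ k → (lsel i → s (i - 1) = s k)) ∧
  (∀ i, 1 ≤ i → i ≤ k → (inL i ↔ (inL (i - 1) ∨ lsel i))) ∧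
  (∀ i, 1 ≤ i → i ≤ k → (inL (i - 1) → ¬ lsel i)) ∧
  (LE ↔ inL k)

end BMC
namespace BMC

variable {AP S : Type}

/-- Lookup of the virtually unrolled formula variable `⟦φ⟧^d_i`, using the
convention `⟦φ⟧^d_i = ⟦φ⟧^{δ(φ)}_i` when `d > δ(φ)`. -/
def pV (v : PLTL AP → ℕ → ℕ → Prop) (φ : PLTL AP) (d i : ℕ) : Prop :=
  v φ (min d φ.delta) i

/-- `⟦LastStateFormula⟧_k` constraints for one subformula `φ` of the PLTL
eventuality encoding. -/
def pLastC (k : ℕ) (lsel : ℕ → Prop) (LE : Prop)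
    (v : PLTL AP → ℕ → ℕ → Prop) (φ : PLTL AP) : Prop :=
  ∀ d, d ≤ φ.delta →
    (¬ LE → ¬ v φ d (k + 1)) ∧
    (∀ i, 1 ≤ i → i ≤ k → lsel i → (v φ d (k + 1) ↔ pV v φ (d + 1) i))

/-- The constraints `⟦EventualityPLTL⟧_k` (together with the
`⟦LastStateFormula⟧_k` constraints) of the PLTL eventuality encoding,
generated for a formula and, recursively, all of its subformulas.
`v φ d i` is the formula variable `⟦φ⟧^d_i` and `aux φ i` the auxiliary
variable `⟨⟨Fψ2⟩⟩^{δ(ψ2)}_i` (for until subformulas `φ = ψ1 U ψ2`)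
resp. `⟨⟨Gψ2⟩⟩^{δ(ψ2)}_i` (for release subformulas). -/
def pevC (k : ℕ) (L : S → Set AP) (s : ℕ → S) (lsel inL : ℕ → Prop)
    (LE : Prop) (v : PLTL AP → ℕ → ℕ → Prop) (aux : PLTL AP → ℕ → Prop) :
    PLTL AP → Prop
  | .atom p =>
      (∀ i, i ≤ k → (v (.atom p) 0 i ↔ p ∈ L (s i))) ∧
      pLastC k lsel LE v (.atom p)
  | .natom p =>
      (∀ i, i ≤ k → (v (.natom p) 0 i ↔ p ∉ L (s i))) ∧
      pLastC k lsel LE v (.natom p)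
  | .conj f g =>
      pevC k L s lsel inL LE v aux f ∧ pevC k L s lsel inL LE v aux g ∧
      (∀ d, d ≤ (PLTL.conj f g).delta → ∀ i, i ≤ k →
        (v (.conj f g) d i ↔ (pV v f d i ∧ pV v g d i))) ∧
      pLastC k lsel LE v (.conj f g)
  | .disj f g =>
      pevC k L s lsel inL LE v aux f ∧ pevC k L s lsel inL LE v aux g ∧
      (∀ d, d ≤ (PLTL.disj f g).delta → ∀ i, i ≤ k →
        (v (.disj f g) d i ↔ (pV v f d i ∨ pV v g d i))) ∧
      pLastC k lsel LE v (.disj f g)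
  | .next f =>
      pevC k L s lsel inL LE v aux f ∧
      (∀ d, d ≤ (PLTL.next f).delta → ∀ i, i ≤ k →
        (v (.next f) d i ↔ pV v f d (i + 1))) ∧
      pLastC k lsel LE v (.next f)
  | .untl f g =>
      pevC k L s lsel inL LE v aux f ∧ pevC k L s lsel inL LE v aux g ∧
      (∀ d, d ≤ (PLTL.untl f g).delta → ∀ i, i ≤ k →
        (v (.untl f g) d i ↔
          (pV v g d i ∨ (pV v f d i ∧ v (.untl f g) d (i + 1))))) ∧
      pLastC k lsel LE v (.untl f g) ∧
      (¬ aux (.untl f g) 0) ∧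
      (∀ i, 1 ≤ i → i ≤ k →
        (aux (.untl f g) i ↔
          (aux (.untl f g) (i - 1) ∨ (inL i ∧ v g g.delta i)))) ∧
      (LE → v (.untl f g) (PLTL.untl f g).delta k → aux (.untl f g) k)
  | .rels f g =>
      pevC k L s lsel inL LE v aux f ∧ pevC k L s lsel inL LE v aux g ∧
      (∀ d, d ≤ (PLTL.rels f g).delta → ∀ i, i ≤ k →
        (v (.rels f g) d i ↔
          (pV v g d i ∧ (pV v f d i ∨ v (.rels f g) d (i + 1))))) ∧
      pLastC k lsel LE v (.rels f g) ∧
      (aux (.rels f g) 0) ∧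
      (∀ i, 1 ≤ i → i ≤ k →
        (aux (.rels f g) i ↔
          (aux (.rels f g) (i - 1) ∧ (¬ inL i ∨ v g g.delta i)))) ∧
      (LE → aux (.rels f g) k → v (.rels f g) (PLTL.rels f g).delta k)
  | .prev f =>
      pevC k L s lsel inL LE v aux f ∧
      (∀ d, d ≤ (PLTL.prev f).delta → ¬ v (.prev f) d 0) ∧
      (∀ i, 1 ≤ i → i ≤ k → (v (.prev f) 0 i ↔ pV v f 0 (i - 1))) ∧
      (∀ d, 1 ≤ d → d ≤ (PLTL.prev f).delta → ∀ i, 1 ≤ i → i ≤ k →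
        (v (.prev f) d i ↔
          ((lsel i ∧ pV v f (d - 1) k) ∨ (¬ lsel i ∧ pV v f d (i - 1))))) ∧
      pLastC k lsel LE v (.prev f)
  | .wprev f =>
      pevC k L s lsel inL LE v aux f ∧
      (∀ d, d ≤ (PLTL.wprev f).delta → v (.wprev f) d 0) ∧
      (∀ i, 1 ≤ i → i ≤ k → (v (.wprev f) 0 i ↔ pV v f 0 (i - 1))) ∧
      (∀ d, 1 ≤ d → d ≤ (PLTL.wprev f).delta → ∀ i, 1 ≤ i → i ≤ k →
        (v (.wprev f) d i ↔
          ((lsel i ∧ pV v f (d - 1) k) ∨ (¬ lsel i ∧ pV v f d (i - 1))))) ∧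
      pLastC k lsel LE v (.wprev f)
  | .since f g =>
      pevC k L s lsel inL LE v aux f ∧ pevC k L s lsel inL LE v aux g ∧
      (∀ d, d ≤ (PLTL.since f g).delta → (v (.since f g) d 0 ↔ pV v g d 0)) ∧
      (∀ i, 1 ≤ i → i ≤ k →
        (v (.since f g) 0 i ↔
          (pV v g 0 i ∨ (pV v f 0 i ∧ v (.since f g) 0 (i - 1))))) ∧
      (∀ d, 1 ≤ d → d ≤ (PLTL.since f g).delta → ∀ i, 1 ≤ i → i ≤ k →
        (v (.since f g) d i ↔
          (pV v g d i ∨ (pV v f d i ∧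
            ((lsel i ∧ v (.since f g) (d - 1) k) ∨
             (¬ lsel i ∧ v (.since f g) d (i - 1))))))) ∧
      pLastC k lsel LE v (.since f g)
  | .trig f g =>
      pevC k L s lsel inL LE v aux f ∧ pevC k L s lsel inL LE v aux g ∧
      (∀ d, d ≤ (PLTL.trig f g).delta → (v (.trig f g) d 0 ↔ pV v g d 0)) ∧
      (∀ i, 1 ≤ i → i ≤ k →
        (v (.trig f g) 0 i ↔
          (pV v g 0 i ∧ (pV v f 0 i ∨ v (.trig f g) 0 (i - 1))))) ∧
      (∀ d, 1 ≤ d → d ≤ (PLTL.trig f g).delta → ∀ i, 1 ≤ i → i ≤ k →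
        (v (.trig f g) d i ↔
          (pV v g d i ∧ (pV v f d i ∨
            ((lsel i ∧ v (.trig f g) (d - 1) k) ∨
             (¬ lsel i ∧ v (.trig f g) d (i - 1))))))) ∧
      pLastC k lsel LE v (.trig f g)

/-- Satisfiability of the PLTL eventuality encoding
`⟦M,ψ,k⟧ = ⟦M⟧_k ∧ ⟦LoopConstraints⟧_k ∧ ⟦LastStateFormula⟧_k ∧
⟦EventualityPLTL⟧_k ∧ ⟦ψ⟧^0_0`. -/
def PEvSat (M : Kripke S AP) (ψ : PLTL AP) (k : ℕ) : Prop :=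
  ∃ (s : ℕ → S) (lsel inL : ℕ → Prop) (LE : Prop)
    (v : PLTL AP → ℕ → ℕ → Prop) (aux : PLTL AP → ℕ → Prop),
    ModelC M k s ∧ LoopC k s lsel inL LE ∧
    pevC k M.L s lsel inL LE v aux ψ ∧ v ψ 0 0

end BMC
namespace BMC

variable {AP S : Type}

/-- Lookup of a proxy formula variable (at index `E` or `L`) with the
convention that unrollings beyond `δ(φ)` are identified with `δ(φ)`. -/
def pW (w : PLTL AP → ℕ → Prop) (φ : PLTL AP) (d : ℕ) : Prop :=
  w φ (min d φ.delta)

/-- Loop constraints of the incremental PLTL eventuality encoding, using the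
proxy state `sE`; the flag `dep` controls whether the `k`-dependent
constraints (`s_E = s_k` and `LoopExists ⇔ InLoop_k`) are included. -/
def incLoopC (dep : Bool) (k : ℕ) (s : ℕ → S) (sE : S)
    (lsel inL : ℕ → Prop) (LE : Prop) : Prop :=
  ¬ lsel 0 ∧ ¬ inL 0 ∧
  (∀ i, 1 ≤ i → i ≤ k → (lsel i → s (i - 1) = sE)) ∧
  (∀ i, 1 ≤ i → i ≤ k → (inL i ↔ (inL (i - 1) ∨ lsel i))) ∧
  (∀ i, 1 ≤ i → i ≤ k → (inL (i - 1) → ¬ lsel i)) ∧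
  (dep = true → (LE ↔ inL k)) ∧
  (dep = true → sE = s k)

/-- The `⟦LastStateFormula⟧_k` constraints of the incremental encoding for one
subformula `φ`, with proxy variables `⟦φ⟧^d_L` and `⟦φ⟧^d_E`; the flag `dep`
controls the `k`-dependent constraints `⟦φ⟧^d_E ⇔ ⟦φ⟧^d_k` and
`⟦φ⟧^d_{k+1} ⇔ ⟦φ⟧^{min(d+1,δ(φ))}_L`. -/
def incLastC (dep : Bool) (k : ℕ) (lsel : ℕ → Prop) (LE : Prop)
    (v : PLTL AP → ℕ → ℕ → Prop) (vE vL : PLTL AP → ℕ → Prop)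
    (φ : PLTL AP) : Prop :=
  ∀ d, d ≤ φ.delta →
    (¬ LE → ¬ vL φ d) ∧
    (∀ i, 1 ≤ i → i ≤ k → lsel i → (vL φ d ↔ v φ d i)) ∧
    (dep = true → (vE φ d ↔ v φ d k)) ∧
    (dep = true → (v φ d (k + 1) ↔ pW vL φ (d + 1)))

/-- The constraints `⟦IncPLTL⟧_k` (together with `⟦LastStateFormula⟧_k`) of
the incremental PLTL eventuality encoding, generated recursively for all
subformulas.  `v φ d i` are the formula variables, `vE`/`vL` the proxy
variables at the proxy indices `E` resp. `L`, `aux φ i` the auxiliary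
variables and `auxE φ` their proxies at index `E`; the flag `dep` controls
whether the `k`-dependent constraints are included. -/
def pincC (dep : Bool) (k : ℕ) (L : S → Set AP) (s : ℕ → S)
    (lsel inL : ℕ → Prop) (LE : Prop) (v : PLTL AP → ℕ → ℕ → Prop)
    (vE vL : PLTL AP → ℕ → Prop) (aux : PLTL AP → ℕ → Prop)
    (auxE : PLTL AP → Prop) : PLTL AP → Prop
  | .atom p =>
      (∀ i, i ≤ k → (v (.atom p) 0 i ↔ p ∈ L (s i))) ∧
      incLastC dep k lsel LE v vE vL (.atom p)
  | .natom p =>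
      (∀ i, i ≤ k → (v (.natom p) 0 i ↔ p ∉ L (s i))) ∧
      incLastC dep k lsel LE v vE vL (.natom p)
  | .conj f g =>
      pincC dep k L s lsel inL LE v vE vL aux auxE f ∧
      pincC dep k L s lsel inL LE v vE vL aux auxE g ∧
      (∀ d, d ≤ (PLTL.conj f g).delta → ∀ i, i ≤ k →
        (v (.conj f g) d i ↔ (pV v f d i ∧ pV v g d i))) ∧
      incLastC dep k lsel LE v vE vL (.conj f g)
  | .disj f g =>
      pincC dep k L s lsel inL LE v vE vL aux auxE f ∧
      pincC dep k L s lsel inL LE v vE vL aux auxE g ∧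
      (∀ d, d ≤ (PLTL.disj f g).delta → ∀ i, i ≤ k →
        (v (.disj f g) d i ↔ (pV v f d i ∨ pV v g d i))) ∧
      incLastC dep k lsel LE v vE vL (.disj f g)
  | .next f =>
      pincC dep k L s lsel inL LE v vE vL aux auxE f ∧
      (∀ d, d ≤ (PLTL.next f).delta → ∀ i, i ≤ k →
        (v (.next f) d i ↔ pV v f d (i + 1))) ∧
      incLastC dep k lsel LE v vE vL (.next f)
  | .untl f g =>
      pincC dep k L s lsel inL LE v vE vL aux auxE f ∧
      pincC dep k L s lsel inL LE v vE vL aux auxE g ∧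
      (∀ d, d ≤ (PLTL.untl f g).delta → ∀ i, i ≤ k →
        (v (.untl f g) d i ↔
          (pV v g d i ∨ (pV v f d i ∧ v (.untl f g) d (i + 1))))) ∧
      incLastC dep k lsel LE v vE vL (.untl f g) ∧
      (¬ aux (.untl f g) 0) ∧
      (∀ i, 1 ≤ i → i ≤ k →
        (aux (.untl f g) i ↔
          (aux (.untl f g) (i - 1) ∨ (inL i ∧ v g g.delta i)))) ∧
      (LE → vE (.untl f g) (PLTL.untl f g).delta → auxE (.untl f g)) ∧
      (dep = true → (auxE (.untl f g) ↔ aux (.untl f g) k))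
  | .rels f g =>
      pincC dep k L s lsel inL LE v vE vL aux auxE f ∧
      pincC dep k L s lsel inL LE v vE vL aux auxE g ∧
      (∀ d, d ≤ (PLTL.rels f g).delta → ∀ i, i ≤ k →
        (v (.rels f g) d i ↔
          (pV v g d i ∧ (pV v f d i ∨ v (.rels f g) d (i + 1))))) ∧
      incLastC dep k lsel LE v vE vL (.rels f g) ∧
      (aux (.rels f g) 0) ∧
      (∀ i, 1 ≤ i → i ≤ k →
        (aux (.rels f g) i ↔
          (aux (.rels f g) (i - 1) ∧ (¬ inL i ∨ v g g.delta i)))) ∧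
      (LE → auxE (.rels f g) → vE (.rels f g) (PLTL.rels f g).delta) ∧
      (dep = true → (auxE (.rels f g) ↔ aux (.rels f g) k))
  | .prev f =>
      pincC dep k L s lsel inL LE v vE vL aux auxE f ∧
      (∀ d, d ≤ (PLTL.prev f).delta → ¬ v (.prev f) d 0) ∧
      (∀ i, 1 ≤ i → i ≤ k → (v (.prev f) 0 i ↔ pV v f 0 (i - 1))) ∧
      (∀ d, 1 ≤ d → d ≤ (PLTL.prev f).delta → ∀ i, 1 ≤ i → i ≤ k →
        (v (.prev f) d i ↔
          ((lsel i ∧ pW vE f (d - 1)) ∨ (¬ lsel i ∧ pV v f d (i - 1))))) ∧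
      incLastC dep k lsel LE v vE vL (.prev f)
  | .wprev f =>
      pincC dep k L s lsel inL LE v vE vL aux auxE f ∧
      (∀ d, d ≤ (PLTL.wprev f).delta → v (.wprev f) d 0) ∧
      (∀ i, 1 ≤ i → i ≤ k → (v (.wprev f) 0 i ↔ pV v f 0 (i - 1))) ∧
      (∀ d, 1 ≤ d → d ≤ (PLTL.wprev f).delta → ∀ i, 1 ≤ i → i ≤ k →
        (v (.wprev f) d i ↔
          ((lsel i ∧ pW vE f (d - 1)) ∨ (¬ lsel i ∧ pV v f d (i - 1))))) ∧
      incLastC dep k lsel LE v vE vL (.wprev f)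
  | .since f g =>
      pincC dep k L s lsel inL LE v vE vL aux auxE f ∧
      pincC dep k L s lsel inL LE v vE vL aux auxE g ∧
      (∀ d, d ≤ (PLTL.since f g).delta → (v (.since f g) d 0 ↔ pV v g d 0)) ∧
      (∀ i, 1 ≤ i → i ≤ k →
        (v (.since f g) 0 i ↔
          (pV v g 0 i ∨ (pV v f 0 i ∧ v (.since f g) 0 (i - 1))))) ∧
      (∀ d, 1 ≤ d → d ≤ (PLTL.since f g).delta → ∀ i, 1 ≤ i → i ≤ k →
        (v (.since f g) d i ↔
          (pV v g d i ∨ (pV v f d i ∧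
            ((lsel i ∧ vE (.since f g) (d - 1)) ∨
             (¬ lsel i ∧ v (.since f g) d (i - 1))))))) ∧
      incLastC dep k lsel LE v vE vL (.since f g)
  | .trig f g =>
      pincC dep k L s lsel inL LE v vE vL aux auxE f ∧
      pincC dep k L s lsel inL LE v vE vL aux auxE g ∧
      (∀ d, d ≤ (PLTL.trig f g).delta → (v (.trig f g) d 0 ↔ pV v g d 0)) ∧
      (∀ i, 1 ≤ i → i ≤ k →
        (v (.trig f g) 0 i ↔
          (pV v g 0 i ∧ (pV v f 0 i ∨ v (.trig f g) 0 (i - 1))))) ∧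
      (∀ d, 1 ≤ d → d ≤ (PLTL.trig f g).delta → ∀ i, 1 ≤ i → i ≤ k →
        (v (.trig f g) d i ↔
          (pV v g d i ∧ (pV v f d i ∨
            ((lsel i ∧ vE (.trig f g) (d - 1)) ∨
             (¬ lsel i ∧ v (.trig f g) d (i - 1))))))) ∧
      incLastC dep k lsel LE v vE vL (.trig f g)

/-- Satisfiability of the incremental PLTL eventuality encoding
`⟦M,ψ,k⟧ = ⟦M⟧_k ∧ ⟦LoopConstraints⟧_k ∧ ⟦LastStateFormula⟧_k ∧
⟦IncPLTL⟧_k ∧ ⟦ψ⟧^0_0` (the witness formula). -/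
def IncSat (M : Kripke S AP) (ψ : PLTL AP) (k : ℕ) : Prop :=
  ∃ (s : ℕ → S) (sE : S) (lsel inL : ℕ → Prop) (LE : Prop)
    (v : PLTL AP → ℕ → ℕ → Prop) (vE vL : PLTL AP → ℕ → Prop)
    (aux : PLTL AP → ℕ → Prop) (auxE : PLTL AP → Prop),
    ModelC M k s ∧ incLoopC true k s sE lsel inL LE ∧
    pincC true k M.L s lsel inL LE v vE vL aux auxE ψ ∧ v ψ 0 0

end BMC
namespace BMC

variable {AP S : Type}

/-- Negation of a PNF formula, via the standard dualities. -/
def PLTL.neg : PLTL AP → PLTL AP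
  | .atom p => .natom p
  | .natom p => .atom p
  | .conj f g => .disj f.neg g.neg
  | .disj f g => .conj f.neg g.neg
  | .next f => .next f.neg
  | .untl f g => .rels f.neg g.neg
  | .rels f g => .untl f.neg g.neg
  | .prev f => .wprev f.neg
  | .wprev f => .prev f.neg
  | .since f g => .trig f.neg g.neg
  | .trig f g => .since f.neg g.neg

/-- The list of subformulas of a PLTL formula. -/
def PLTL.subfs : PLTL AP → List (PLTL AP)
  | .atom p => [.atom p]
  | .natom p => [.natom p]
  | .conj f g => .conj f g :: (f.subfs ++ g.subfs)
  | .disj f g => .disj f g :: (f.subfs ++ g.subfs)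
  | .next f => .next f :: f.subfs
  | .untl f g => .untl f g :: (f.subfs ++ g.subfs)
  | .rels f g => .rels f g :: (f.subfs ++ g.subfs)
  | .prev f => .prev f :: f.subfs
  | .wprev f => .wprev f :: f.subfs
  | .since f g => .since f g :: (f.subfs ++ g.subfs)
  | .trig f g => .trig f g :: (f.subfs ++ g.subfs)

/-- `φ` is an until or release formula (so that it carries auxiliary
variables in the encoding). -/
def PLTL.isUR : PLTL AP → Prop
  | .untl _ _ => True
  | .rels _ _ => True
  | _ => False

/-- The simple path formula `⟦SimplePath⟧_k` for the incremental encoding of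
the formula `χ`: any two distinct positions `i < j ≤ k` differ in the system
state, in `InLoop`, in the formula variables at unrolling `0`, or (when both
are in the loop) in the full vectors of formula variables or of auxiliary
variables. -/
def SimplePathC (χ : PLTL AP) (k : ℕ) (s : ℕ → S) (inL : ℕ → Prop)
    (v : PLTL AP → ℕ → ℕ → Prop) (aux : PLTL AP → ℕ → Prop) : Prop :=
  ∀ i j, i < j → j ≤ k →
    (s i ≠ s j ∨
     ¬ (inL i ↔ inL j) ∨
     (∃ φ ∈ χ.subfs, ¬ (v φ 0 i ↔ v φ 0 j)) ∨
     (inL i ∧ inL j ∧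
       ((∃ φ ∈ χ.subfs, ∃ d, d ≤ PLTL.delta φ ∧ ¬ (v φ d i ↔ v φ d j)) ∨
        (∃ φ ∈ χ.subfs, φ.isUR ∧ ¬ (aux φ i ↔ aux φ j)))))

/-- Satisfiability of the witness formula `⟦M,χ,k⟧` conjoined with the simple
path formula `⟦SimplePath⟧_k`. -/
def WitSPSat (M : Kripke S AP) (χ : PLTL AP) (k : ℕ) : Prop :=
  ∃ (s : ℕ → S) (sE : S) (lsel inL : ℕ → Prop) (LE : Prop)
    (v : PLTL AP → ℕ → ℕ → Prop) (vE vL : PLTL AP → ℕ → Prop)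
    (aux : PLTL AP → ℕ → Prop) (auxE : PLTL AP → Prop),
    ModelC M k s ∧ incLoopC true k s sE lsel inL LE ∧
    pincC true k M.L s lsel inL LE v vE vL aux auxE χ ∧ v χ 0 0 ∧
    SimplePathC χ k s inL v aux

/-- Satisfiability of the completeness formula `⟦⟦M,χ,k⟧⟧` (the witness
formula with all `k`-dependent constraints removed) conjoined with the simple
path formula `⟦SimplePath⟧_k`. -/
def ComplSPSat (M : Kripke S AP) (χ : PLTL AP) (k : ℕ) : Prop :=
  ∃ (s : ℕ → S) (sE : S) (lsel inL : ℕ → Prop) (LE : Prop)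
    (v : PLTL AP → ℕ → ℕ → Prop) (vE vL : PLTL AP → ℕ → Prop)
    (aux : PLTL AP → ℕ → Prop) (auxE : PLTL AP → Prop),
    ModelC M k s ∧ incLoopC false k s sE lsel inL LE ∧
    pincC false k M.L s lsel inL LE v vE vL aux auxE χ ∧ v χ 0 0 ∧
    SimplePathC χ k s inL v aux

/-- `M ⊨ ψ`: every initialised infinite path of `M` satisfies `ψ`. -/
def Kripke.Models (M : Kripke S AP) (ψ : PLTL AP) : Prop :=
  ∀ π : ℕ → S, M.InitPath π → PLTL.sat M.L π ψ 0

end BMC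
namespace BMC

variable {AP S : Type}

def sU (F G : ℕ → Prop) (i : ℕ) : Prop :=
  ∃ j, i ≤ j ∧ G j ∧ ∀ n, i ≤ n → n < j → F n
def sR (F G : ℕ → Prop) (i : ℕ) : Prop :=
  ∀ j, i ≤ j → (G j ∨ ∃ n, i ≤ n ∧ n < j ∧ F n)
def sS (F G : ℕ → Prop) (i : ℕ) : Prop :=
  ∃ j, j ≤ i ∧ G j ∧ ∀ n, j < n → n ≤ i → F n
def sT (F G : ℕ → Prop) (i : ℕ) : Prop :=
  ∀ j, j ≤ i → (G j ∨ ∃ n, j < n ∧ n ≤ i ∧ F n)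

lemma sR_iff (F G : ℕ → Prop) (i : ℕ) :
    sR F G i ↔ ¬ sU (fun n => ¬ F n) (fun n => ¬ G n) i := by
  unfold sR sU
  push Not
  constructor
  · intro h j hj hg
    exact (h j hj).resolve_left hg
  · intro h j hj
    by_cases hg : G j
    · exact Or.inl hg
    · exact Or.inr (h j hj hg)

lemma sT_iff (F G : ℕ → Prop) (i : ℕ) :
    sT F G i ↔ ¬ sS (fun n => ¬ F n) (fun n => ¬ G n) i := by
  unfold sT sS
  push Not
  constructor
  · intro h j hj hg
    exact (h j hj).resolve_left hg
  · intro h j hj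
    by_cases hg : G j
    · exact Or.inl hg
    · exact Or.inr (h j hj hg)

lemma sU_step (F G : ℕ → Prop) (i : ℕ) :
    sU F G i ↔ G i ∨ (F i ∧ sU F G (i + 1)) := by
  constructor
  · rintro ⟨j, hj, hg, hf⟩
    rcases Nat.eq_or_lt_of_le hj with rfl | h
    · exact Or.inl hg
    · exact Or.inr ⟨hf i le_rfl h, j, h, hg, fun n h1 h2 => hf n (by omega) h2⟩
  · rintro (hg | ⟨hf, j, hj, hg, hF⟩)
    · exact ⟨i, le_rfl, hg, fun n h1 h2 => by omega⟩
    · refine ⟨j, by omega, hg, fun n h1 h2 => ?_⟩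
      rcases Nat.eq_or_lt_of_le h1 with rfl | h
      · exact hf
      · exact hF n h h2

lemma sR_step (F G : ℕ → Prop) (i : ℕ) :
    sR F G i ↔ G i ∧ (F i ∨ sR F G (i + 1)) := by
  rw [sR_iff, sR_iff, sU_step]; tauto

lemma sS_zero (F G : ℕ → Prop) : sS F G 0 ↔ G 0 := by
  constructor
  · rintro ⟨j, hj, hg, -⟩
    obtain rfl : j = 0 := by omega
    exact hg
  · intro h
    exact ⟨0, le_rfl, h, fun n h1 h2 => by omega⟩

lemma sS_succ (F G : ℕ → Prop) (i : ℕ) :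
    sS F G (i + 1) ↔ G (i + 1) ∨ (F (i + 1) ∧ sS F G i) := by
  constructor
  · rintro ⟨j, hj, hg, hf⟩
    rcases Nat.eq_or_lt_of_le hj with rfl | h
    · exact Or.inl hg
    · exact Or.inr ⟨hf _ h le_rfl, j, by omega, hg, fun n h1 h2 => hf n h1 (by omega)⟩
  · rintro (hg | ⟨hf, j, hj, hg, hF⟩)
    · exact ⟨i + 1, le_rfl, hg, fun n h1 h2 => by omega⟩
    · refine ⟨j, by omega, hg, fun n h1 h2 => ?_⟩
      rcases Nat.eq_or_lt_of_le h2 with rfl | h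
      · exact hf
      · exact hF n h1 (by omega)

lemma sT_zero (F G : ℕ → Prop) : sT F G 0 ↔ G 0 := by
  rw [sT_iff, sS_zero]; tauto

lemma sT_succ (F G : ℕ → Prop) (i : ℕ) :
    sT F G (i + 1) ↔ G (i + 1) ∧ (F (i + 1) ∨ sT F G i) := by
  rw [sT_iff, sT_iff, sS_succ]; tauto

lemma U_char {A F G : ℕ → Prop} (h : ∀ n, A n ↔ (G n ∨ (F n ∧ A (n + 1))))
    (inf : ∀ n, ∃ m, n ≤ m ∧ (¬ A m ∨ G m)) (n : ℕ) : A n ↔ sU F G n := by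
  have key : ∀ t n, (¬ A (n + t) ∨ G (n + t)) → (A n ↔ sU F G n) := by
    intro t
    induction t with
    | zero =>
      intro n hn
      rw [Nat.add_zero] at hn
      rcases hn with hn | hn
      · have h1 := h n
        constructor
        · intro h2; exact absurd h2 hn
        · rintro ⟨j, hj, hg, hf⟩
          exfalso
          have : ∀ t, t ≤ j - n → A (j - t) := by
            intro t
            induction t with
            | zero => intro _; exact (h _).2 (Or.inl (by simpa using hg))
            | succ t ih =>
              intro ht
              refine (h _).2 (Or.inr ⟨hf _ (by omega) (by omega), ?_⟩)
              have := ih (by omega)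
              rwa [show j - (t + 1) + 1 = j - t by omega]
          apply hn
          have := this (j - n) le_rfl
          rwa [show j - (j - n) = n by omega] at this
      · rw [sU_step, h n]; tauto
    | succ t ih =>
      intro n hn
      rw [sU_step, h n, ih (n + 1) (by rwa [show n + 1 + t = n + (t + 1) by omega])]
  obtain ⟨m, hm, hA⟩ := inf n
  refine key (m - n) n ?_
  rwa [show n + (m - n) = m by omega]

lemma R_char {A F G : ℕ → Prop} (h : ∀ n, A n ↔ (G n ∧ (F n ∨ A (n + 1))))
    (inf : ∀ n, ∃ m, n ≤ m ∧ (A m ∨ ¬ G m)) (n : ℕ) : A n ↔ sR F G n := by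
  rw [sR_iff, ← U_char (A := fun n => ¬ A n) (F := fun n => ¬ F n) (G := fun n => ¬ G n)]
  · tauto
  · intro n; have := h n; tauto
  · intro n
    obtain ⟨m, h1, h2⟩ := inf n
    exact ⟨m, h1, by tauto⟩

lemma S_char {A F G : ℕ → Prop} (h0 : A 0 ↔ G 0)
    (h : ∀ n, A (n + 1) ↔ (G (n + 1) ∨ (F (n + 1) ∧ A n))) (n : ℕ) : A n ↔ sS F G n := by
  induction n with
  | zero => rw [h0, sS_zero]
  | succ n ih => rw [h, sS_succ, ih]

lemma T_char {A F G : ℕ → Prop} (h0 : A 0 ↔ G 0)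
    (h : ∀ n, A (n + 1) ↔ (G (n + 1) ∧ (F (n + 1) ∨ A n))) (n : ℕ) : A n ↔ sT F G n := by
  induction n with
  | zero => rw [h0, sT_zero]
  | succ n ih => rw [h, sT_succ, ih]

lemma sat_untl (L : S → Set AP) (π : ℕ → S) (f g : PLTL AP) (i : ℕ) :
    PLTL.sat L π (.untl f g) i ↔ sU (PLTL.sat L π f) (PLTL.sat L π g) i := Iff.rfl
lemma sat_rels (L : S → Set AP) (π : ℕ → S) (f g : PLTL AP) (i : ℕ) :
    PLTL.sat L π (.rels f g) i ↔ sR (PLTL.sat L π f) (PLTL.sat L π g) i := Iff.rfl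
lemma sat_since (L : S → Set AP) (π : ℕ → S) (f g : PLTL AP) (i : ℕ) :
    PLTL.sat L π (.since f g) i ↔ sS (PLTL.sat L π f) (PLTL.sat L π g) i := Iff.rfl
lemma sat_trig (L : S → Set AP) (π : ℕ → S) (f g : PLTL AP) (i : ℕ) :
    PLTL.sat L π (.trig f g) i ↔ sT (PLTL.sat L π f) (PLTL.sat L π g) i := Iff.rfl
lemma sat_prev_succ (L : S → Set AP) (π : ℕ → S) (f : PLTL AP) (i : ℕ) :
    PLTL.sat L π (.prev f) (i + 1) ↔ PLTL.sat L π f i := by simp [PLTL.sat]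
lemma sat_wprev_succ (L : S → Set AP) (π : ℕ → S) (f : PLTL AP) (i : ℕ) :
    PLTL.sat L π (.wprev f) (i + 1) ↔ PLTL.sat L π f i := by simp [PLTL.sat]
lemma sat_prev_zero (L : S → Set AP) (π : ℕ → S) (f : PLTL AP) :
    ¬ PLTL.sat L π (.prev f) 0 := by simp [PLTL.sat]
lemma sat_wprev_zero (L : S → Set AP) (π : ℕ → S) (f : PLTL AP) :
    PLTL.sat L π (.wprev f) 0 := by simp [PLTL.sat]
lemma sat_next (L : S → Set AP) (π : ℕ → S) (f : PLTL AP) (i : ℕ) :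
    PLTL.sat L π (.next f) i ↔ PLTL.sat L π f (i + 1) := Iff.rfl

lemma sat_neg (L : S → Set AP) (π : ℕ → S) (φ : PLTL AP) :
    ∀ i, PLTL.sat L π φ.neg i ↔ ¬ PLTL.sat L π φ i := by
  induction φ with
  | atom p => intro i; rfl
  | natom p => intro i; simp [PLTL.sat, PLTL.neg]
  | conj f g hf hg => intro i; simp only [PLTL.sat, PLTL.neg, hf, hg]; tauto
  | disj f g hf hg => intro i; simp only [PLTL.sat, PLTL.neg, hf, hg]; tauto
  | next f hf => intro i; simp only [PLTL.sat, PLTL.neg, hf]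
  | untl f g hf hg =>
    intro i
    have e1 : PLTL.sat L π f.neg = fun n => ¬ PLTL.sat L π f n := funext fun n => propext (hf n)
    have e2 : PLTL.sat L π g.neg = fun n => ¬ PLTL.sat L π g n := funext fun n => propext (hg n)
    rw [PLTL.neg, sat_rels, sat_untl, sR_iff, e1, e2]
    simp only [not_not]
  | rels f g hf hg =>
    intro i
    have e1 : PLTL.sat L π f.neg = fun n => ¬ PLTL.sat L π f n := funext fun n => propext (hf n)
    have e2 : PLTL.sat L π g.neg = fun n => ¬ PLTL.sat L π g n := funext fun n => propext (hg n)
    rw [PLTL.neg, sat_rels, sat_untl, sR_iff, e1, e2, not_not]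
  | prev f hf =>
    intro i
    cases i with
    | zero => simp [PLTL.sat, PLTL.neg]
    | succ i => rw [PLTL.neg, sat_prev_succ, sat_wprev_succ, hf]
  | wprev f hf =>
    intro i
    cases i with
    | zero => simp [PLTL.sat, PLTL.neg]
    | succ i => rw [PLTL.neg, sat_prev_succ, sat_wprev_succ, hf]
  | since f g hf hg =>
    intro i
    have e1 : PLTL.sat L π f.neg = fun n => ¬ PLTL.sat L π f n := funext fun n => propext (hf n)
    have e2 : PLTL.sat L π g.neg = fun n => ¬ PLTL.sat L π g n := funext fun n => propext (hg n)
    rw [PLTL.neg, sat_trig, sat_since, sT_iff, e1, e2]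
    simp only [not_not]
  | trig f g hf hg =>
    intro i
    have e1 : PLTL.sat L π f.neg = fun n => ¬ PLTL.sat L π f n := funext fun n => propext (hf n)
    have e2 : PLTL.sat L π g.neg = fun n => ¬ PLTL.sat L π g n := funext fun n => propext (hg n)
    rw [PLTL.neg, sat_trig, sat_since, sT_iff, e1, e2, not_not]

/-- decomposition of a position on a lasso -/
def dd (l p N : ℕ) : ℕ := (N - l) / p
def ii (l p N : ℕ) : ℕ := N - dd l p N * p

lemma dd_ii (l p N : ℕ) : N = ii l p N + dd l p N * p := by
  have := Nat.div_mul_le_self (N - l) p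
  unfold ii dd; omega

lemma ii_lt {l p : ℕ} (hp : 0 < p) (N : ℕ) : ii l p N < l + p := by
  have h1 := Nat.div_add_mod' (N - l) p
  have h2 := Nat.mod_lt (N - l) hp
  unfold ii dd; omega

lemma lt_or_le_ii {l p : ℕ} (N : ℕ) : (N < l ∧ dd l p N = 0 ∧ ii l p N = N) ∨ l ≤ ii l p N := by
  by_cases h : N < l
  · left
    have : dd l p N = 0 := by unfold dd; rw [show N - l = 0 by omega, Nat.zero_div]
    refine ⟨h, this, ?_⟩
    unfold ii; rw [this]; omega
  · right
    have := Nat.div_mul_le_self (N - l) p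
    unfold ii dd; omega

lemma dd_ii_loop {l p : ℕ} (i d : ℕ) (h1 : l ≤ i) (h2 : i < l + p) :
    dd l p (i + d * p) = d ∧ ii l p (i + d * p) = i := by
  have : dd l p (i + d * p) = d := by
    unfold dd
    rw [show i + d * p - l = (i - l) + d * p by omega, Nat.add_mul_div_right _ _ (by omega),
      Nat.div_eq_of_lt (by omega)]
    omega
  refine ⟨this, ?_⟩
  unfold ii; rw [this]; omega

lemma dd_ii_pre {l p : ℕ} (i : ℕ) (h : i < l) : dd l p i = 0 ∧ ii l p i = i := by
  rcases lt_or_le_ii (l := l) (p := p) i with h1 | h1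
  · exact h1.2
  · unfold ii at h1; omega

lemma dd_ii_step {l p : ℕ} (hp : 0 < p) (N : ℕ) :
    (ii l p N + 1 < l + p ∧ dd l p (N + 1) = dd l p N ∧ ii l p (N + 1) = ii l p N + 1) ∨
    (ii l p N + 1 = l + p ∧ dd l p (N + 1) = dd l p N + 1 ∧ ii l p (N + 1) = l) := by
  have h1 := ii_lt (l := l) hp N
  have h2 := dd_ii l p N
  rcases lt_or_le_ii (l := l) (p := p) N with ⟨h3, h4, h5⟩ | h3
  · left
    refine ⟨by omega, ?_⟩
    rw [h4, h5]
    by_cases h6 : N + 1 < l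
    · exact dd_ii_pre _ h6
    · have := dd_ii_loop (l := l) (p := p) (N + 1) 0 (by omega) (by omega)
      simpa using this
  · by_cases h6 : ii l p N + 1 < l + p
    · left
      refine ⟨h6, ?_⟩
      have := dd_ii_loop (l := l) (p := p) (ii l p N + 1) (dd l p N) (by omega) h6
      rwa [show ii l p N + 1 + dd l p N * p = N + 1 by omega] at this
    · right
      refine ⟨by omega, ?_⟩
      have := dd_ii_loop (l := l) (p := p) l (dd l p N + 1) le_rfl (by omega)
      rwa [show l + (dd l p N + 1) * p = N + 1 by rw [Nat.succ_mul]; omega] at this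

end BMC
namespace BMC

variable {AP S : Type}

def good (L : S → Set AP) (π : ℕ → S) : PLTL AP → ℕ → Prop
  | .untl f g, m => ¬ PLTL.sat L π (.untl f g) m ∨ PLTL.sat L π g m
  | .rels f g, m => PLTL.sat L π (.rels f g) m ∨ ¬ PLTL.sat L π g m
  | _, _ => True

lemma good_ex (L : S → Set AP) (π : ℕ → S) (φ : PLTL AP) (n : ℕ) :
    ∃ m, n ≤ m ∧ good L π φ m := by
  cases φ with
  | untl f g =>
    by_cases h : PLTL.sat L π (.untl f g) n
    · obtain ⟨j, h1, h2, -⟩ := h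
      exact ⟨j, h1, Or.inr h2⟩
    · exact ⟨n, le_rfl, Or.inl h⟩
  | rels f g =>
    by_cases h : PLTL.sat L π (.rels f g) n
    · exact ⟨n, le_rfl, Or.inl h⟩
    · rw [sat_rels, sR_iff, not_not] at h
      obtain ⟨j, h1, h2, -⟩ := h
      exact ⟨j, h1, Or.inr h2⟩
  | _ => exact ⟨n, le_rfl, trivial⟩

lemma mem_subfs_self (φ : PLTL AP) : φ ∈ φ.subfs := by
  cases φ <;> simp [PLTL.subfs]

def SameT (L : S → Set AP) (π : ℕ → S) (χ : PLTL AP) (a b : ℕ) : Prop :=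
  π a = π b ∧ ∀ φ ∈ χ.subfs, (PLTL.sat L π φ a ↔ PLTL.sat L π φ b)

def Remap (L : S → Set AP) (π : ℕ → S) (χ : PLTL AP) (h : ℕ → ℕ) : Prop :=
  h 0 = 0 ∧ (∀ n, ∃ e, h (n + 1) = e + 1 ∧ SameT L π χ e (h n)) ∧
  ∀ φ ∈ χ.subfs, ∀ n, ∃ m, n ≤ m ∧ good L π φ (h m)

lemma remap_sat (L : S → Set AP) (π : ℕ → S) (χ : PLTL AP) (h : ℕ → ℕ)
    (H : Remap L π χ h) (φ : PLTL AP) (hs : ∀ x ∈ φ.subfs, x ∈ χ.subfs) :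
    ∀ n, PLTL.sat L (fun n => π (h n)) φ n ↔ PLTL.sat L π φ (h n) := by
  obtain ⟨h0, hst, hg⟩ := H
  have hself := hs _ (mem_subfs_self φ)
  induction φ with
  | atom p => intro n; rfl
  | natom p => intro n; rfl
  | conj f g ihf ihg =>
    simp only [PLTL.subfs, List.mem_cons, List.mem_append] at hs
    have hf := ihf (fun x hx => hs x (by tauto)) (hs _ (by simp [mem_subfs_self]))
    have hg := ihg (fun x hx => hs x (by tauto)) (hs _ (by simp [mem_subfs_self]))
    intro n; simp only [PLTL.sat, hf, hg]
  | disj f g ihf ihg =>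
    simp only [PLTL.subfs, List.mem_cons, List.mem_append] at hs
    have hf := ihf (fun x hx => hs x (by tauto)) (hs _ (by simp [mem_subfs_self]))
    have hg := ihg (fun x hx => hs x (by tauto)) (hs _ (by simp [mem_subfs_self]))
    intro n; simp only [PLTL.sat, hf, hg]
  | next f ihf =>
    simp only [PLTL.subfs, List.mem_cons] at hs
    have hf := ihf (fun x hx => hs x (by tauto)) (hs _ (by simp [mem_subfs_self]))
    intro n
    obtain ⟨e, he, h1, h2⟩ := hst n
    rw [← h2 _ hself, sat_next, sat_next, hf, he]
  | untl f g ihf ihg =>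
    simp only [PLTL.subfs, List.mem_cons, List.mem_append] at hs
    have hfm := hs f (by simp [mem_subfs_self])
    have hgm := hs g (by simp [mem_subfs_self])
    have hf := ihf (fun x hx => hs x (by tauto)) hfm
    have hg' := ihg (fun x hx => hs x (by tauto)) hgm
    intro n
    rw [sat_untl, ← U_char (A := fun n => PLTL.sat L π (.untl f g) (h n))]
    · intro n
      obtain ⟨e, he, h1, h2⟩ := hst n
      show PLTL.sat L π (.untl f g) (h n) ↔ _ ∨ (_ ∧ PLTL.sat L π (.untl f g) (h (n + 1)))
      rw [hf, hg', ← h2 _ hself, ← h2 _ hfm, ← h2 _ hgm, he, sat_untl, sU_step]; rfl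
    · intro n
      obtain ⟨m, h1, h2⟩ := hg _ hself n
      refine ⟨m, h1, ?_⟩
      rw [hg']; exact h2
  | rels f g ihf ihg =>
    simp only [PLTL.subfs, List.mem_cons, List.mem_append] at hs
    have hfm := hs f (by simp [mem_subfs_self])
    have hgm := hs g (by simp [mem_subfs_self])
    have hf := ihf (fun x hx => hs x (by tauto)) hfm
    have hg' := ihg (fun x hx => hs x (by tauto)) hgm
    intro n
    rw [sat_rels, ← R_char (A := fun n => PLTL.sat L π (.rels f g) (h n))]
    · intro n
      obtain ⟨e, he, h1, h2⟩ := hst n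
      show PLTL.sat L π (.rels f g) (h n) ↔ _ ∧ (_ ∨ PLTL.sat L π (.rels f g) (h (n + 1)))
      rw [hf, hg', ← h2 _ hself, ← h2 _ hfm, ← h2 _ hgm, he, sat_rels, sR_step]; rfl
    · intro n
      obtain ⟨m, h1, h2⟩ := hg _ hself n
      refine ⟨m, h1, ?_⟩
      rw [hg']; exact h2
  | prev f ihf =>
    simp only [PLTL.subfs, List.mem_cons] at hs
    have hfm := hs f (by simp [mem_subfs_self])
    have hf := ihf (fun x hx => hs x (by tauto)) hfm
    intro n
    cases n with
    | zero => rw [h0]; simp [PLTL.sat]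
    | succ n =>
      obtain ⟨e, he, h1, h2⟩ := hst n
      rw [sat_prev_succ, he, sat_prev_succ, hf, h2 _ hfm]
  | wprev f ihf =>
    simp only [PLTL.subfs, List.mem_cons] at hs
    have hfm := hs f (by simp [mem_subfs_self])
    have hf := ihf (fun x hx => hs x (by tauto)) hfm
    intro n
    cases n with
    | zero => rw [h0]; simp [PLTL.sat]
    | succ n =>
      obtain ⟨e, he, h1, h2⟩ := hst n
      rw [sat_wprev_succ, he, sat_wprev_succ, hf, h2 _ hfm]
  | since f g ihf ihg =>
    simp only [PLTL.subfs, List.mem_cons, List.mem_append] at hs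
    have hf := ihf (fun x hx => hs x (by tauto)) (hs _ (by simp [mem_subfs_self]))
    have hg' := ihg (fun x hx => hs x (by tauto)) (hs _ (by simp [mem_subfs_self]))
    intro n
    rw [sat_since, ← S_char (A := fun n => PLTL.sat L π (.since f g) (h n))]
    · show PLTL.sat L π (.since f g) (h 0) ↔ _
      rw [hg', h0, sat_since, sS_zero]
    · intro n
      obtain ⟨e, he, h1, h2⟩ := hst n
      show PLTL.sat L π (.since f g) (h (n + 1)) ↔ _ ∨ (_ ∧ PLTL.sat L π (.since f g) (h n))
      rw [hf, hg', ← h2 _ hself, he, sat_since, sS_succ]; rfl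
  | trig f g ihf ihg =>
    simp only [PLTL.subfs, List.mem_cons, List.mem_append] at hs
    have hf := ihf (fun x hx => hs x (by tauto)) (hs _ (by simp [mem_subfs_self]))
    have hg' := ihg (fun x hx => hs x (by tauto)) (hs _ (by simp [mem_subfs_self]))
    intro n
    rw [sat_trig, ← T_char (A := fun n => PLTL.sat L π (.trig f g) (h n))]
    · show PLTL.sat L π (.trig f g) (h 0) ↔ _
      rw [hg', h0, sat_trig, sT_zero]
    · intro n
      obtain ⟨e, he, h1, h2⟩ := hst n
      show PLTL.sat L π (.trig f g) (h (n + 1)) ↔ _ ∧ (_ ∨ PLTL.sat L π (.trig f g) (h n))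
      rw [hf, hg', ← h2 _ hself, he, sat_trig, sT_succ]; rfl

lemma remap_init {M : Kripke S AP} {π : ℕ → S} (hπ : M.InitPath π) {χ : PLTL AP} {h : ℕ → ℕ}
    (H : Remap M.L π χ h) : M.InitPath (fun n => π (h n)) := by
  refine ⟨by simpa [H.1] using hπ.1, fun n => ?_⟩
  obtain ⟨e, he, h1, -⟩ := H.2.1 n
  show M.T (π (h n)) (π (h (n + 1)))
  rw [he, ← h1]
  exact hπ.2 e

/-- loop witnesses -/
def LW (M : Kripke S AP) (χ : PLTL AP) (k : ℕ) : Prop :=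
  ∃ π l, M.InitPath π ∧ IsKLoop π k l ∧ PLTL.sat M.L π χ 0

lemma remap_LW {M : Kripke S AP} {π : ℕ → S} (hπ : M.InitPath π) {χ : PLTL AP} {h : ℕ → ℕ}
    (H : Remap M.L π χ h) (hs : PLTL.sat M.L π χ 0) {k l : ℕ}
    (hl : IsKLoop (fun n => π (h n)) k l) : LW M χ k := by
  refine ⟨_, l, remap_init hπ H, hl, ?_⟩
  rw [remap_sat M.L π χ h H χ (fun x hx => hx), H.1]
  exact hs

lemma LW_succ {M : Kripke S AP} {χ : PLTL AP} {k : ℕ} (h : LW M χ k) : LW M χ (k + 1) := by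
  obtain ⟨π, l, h1, ⟨h2, h3, h4, h5⟩, h6⟩ := h
  refine ⟨π, l + 1, h1, ⟨by omega, by omega, ?_, fun i hi => ?_⟩, h6⟩
  · have := h5 l le_rfl
    rw [show l + (k + 1 - l) = k + 1 by omega] at this
    rw [this]; rfl
  · rw [show k + 1 + 1 - (l + 1) = k + 1 - l by omega]
    exact h5 i (by omega)

lemma LW_mono {M : Kripke S AP} {χ : PLTL AP} {k k' : ℕ} (hk : k ≤ k') (h : LW M χ k) :
    LW M χ k' := by
  induction hk with
  | refl => exact h
  | step _ ih => exact LW_succ ih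

lemma LW_exists [Finite S] {M : Kripke S AP} {π : ℕ → S} (hπ : M.InitPath π) {χ : PLTL AP}
    (hs : PLTL.sat M.L π χ 0) : ∃ k, LW M χ k := by
  classical
  haveI hfin : Finite {φ // φ ∈ χ.subfs} := (List.finite_toSet χ.subfs).to_subtype
  let t : ℕ → S × ({φ // φ ∈ χ.subfs} → Prop) :=
    fun n => (π n, fun φ => PLTL.sat M.L π φ.1 n)
  obtain ⟨q, hq⟩ := Finite.exists_infinite_fiber t
  have hq' : (t ⁻¹' {q}).Infinite := Set.infinite_coe_iff.1 hq
  obtain ⟨a, ha⟩ := hq'.nonempty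
  choose m hm using fun φ : {φ // φ ∈ χ.subfs} => good_ex M.L π φ.1 (a + 1)
  obtain ⟨B, hB⟩ := (Set.finite_range m).bddAbove
  obtain ⟨b, hb, hab⟩ := hq'.exists_gt (max a B)
  have hsame : SameT M.L π χ a b := by
    have : t a = t b := by rw [show t a = q from ha, show t b = q from hb]
    refine ⟨congrArg Prod.fst this, fun φ hφ => ?_⟩
    have := congrFun (congrArg Prod.snd this) ⟨φ, hφ⟩
    exact iff_of_eq this
  have hab1 : a < b := lt_of_le_of_lt (le_max_left _ _) hab
  have hab2 : B < b := lt_of_le_of_lt (le_max_right _ _) hab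
  have hp : 0 < b - a := by omega
  have H : Remap M.L π χ (ii (a + 1) (b - a)) := by
    refine ⟨(dd_ii_pre 0 (by omega)).2, fun n => ?_, fun φ hφ n => ?_⟩
    · rcases dd_ii_step (l := a + 1) hp n with ⟨h1, h2, h3⟩ | ⟨h1, h2, h3⟩
      · exact ⟨_, h3, rfl, fun _ _ => Iff.rfl⟩
      · refine ⟨a, h3, ?_⟩
        rw [show ii (a + 1) (b - a) n = b by omega]
        exact hsame
    · obtain ⟨h1, h2⟩ := hm ⟨φ, hφ⟩
      have h3 : m ⟨φ, hφ⟩ ≤ B := hB ⟨_, rfl⟩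
      refine ⟨m ⟨φ, hφ⟩ + n * (b - a), ?_, ?_⟩
      · have := Nat.le_mul_of_pos_right n hp
        omega
      · rw [(dd_ii_loop _ _ h1 (by omega)).2]
        exact h2
  refine ⟨b, remap_LW hπ H hs (l := a + 1) ⟨by omega, by omega, ?_, fun i hi => ?_⟩⟩
  · have h1 := (dd_ii_pre (l := a + 1) (p := b - a) a (by omega)).2
    have h2 := (dd_ii_loop (l := a + 1) (p := b - a) b 0 (by omega) (by omega)).2
    simp only [Nat.zero_mul, Nat.add_zero] at h2
    simp only [Nat.add_sub_cancel, h1, h2]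
    exact hsame.1
  · have h0 := lt_or_le_ii (l := a + 1) (p := b - a) i
    have h2 := dd_ii (a + 1) (b - a) i
    have h3 := ii_lt (l := a + 1) hp i
    have h4 := dd_ii_loop (l := a + 1) (p := b - a) (ii (a + 1) (b - a) i)
      (dd (a + 1) (b - a) i + 1) (by omega) h3
    rw [Nat.succ_mul, ← Nat.add_assoc, ← h2] at h4
    show π (ii _ _ (i + _)) = _
    rw [show b + 1 - (a + 1) = b - a by omega, h4.2]

/-! stability -/

lemma sU_per {F G : ℕ → Prop} {p n0 : ℕ} (hF : ∀ n, n0 ≤ n → (F (n + p) ↔ F n))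
    (hG : ∀ n, n0 ≤ n → (G (n + p) ↔ G n)) (n : ℕ) (hn : n0 ≤ n) :
    sU F G (n + p) ↔ sU F G n := by
  constructor
  · rintro ⟨j, h1, h2, h3⟩
    refine ⟨j - p, by omega, ?_, fun m h4 h5 => ?_⟩
    · rw [← hG _ (by omega), show j - p + p = j by omega]; exact h2
    · rw [← hF _ (by omega)]; exact h3 _ (by omega) (by omega)
  · rintro ⟨j, h1, h2, h3⟩
    refine ⟨j + p, by omega, (hG _ (by omega)).2 h2, fun m h4 h5 => ?_⟩
    have := (hF (m - p) (by omega)).2 (h3 _ (by omega) (by omega))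
    rwa [show m - p + p = m by omega] at this

lemma per_all {F : ℕ → Prop} {p n0 : ℕ} (hp : 0 < p) (hF : ∀ n, n0 ≤ n → (F (n + p) ↔ F n))
    (a : ℕ) (ha : n0 ≤ a) (h : ∀ n, a ≤ n → n < a + p → F n) : ∀ n, n0 ≤ n → F n := by
  have up : ∀ n, a ≤ n → F n := by
    intro n
    induction n using Nat.strong_induction_on with
    | _ n ih =>
      intro hn
      by_cases h1 : n < a + p
      · exact h n hn h1
      · have := (hF (n - p) (by omega)).2 (ih (n - p) (by omega) (by omega))
        rwa [show n - p + p = n by omega] at this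
  have shift : ∀ t n, n0 ≤ n → (F (n + t * p) ↔ F n) := by
    intro t
    induction t with
    | zero => intro n _; simp
    | succ t ih =>
      intro n hn
      rw [Nat.succ_mul, ← Nat.add_assoc, hF _ (by omega), ih n hn]
  intro n hn
  rw [← shift a n hn]
  apply up
  have := Nat.le_mul_of_pos_right a hp
  omega

lemma sS_per {F G : ℕ → Prop} {p n0 : ℕ} (hp : 0 < p) (hF : ∀ n, n0 ≤ n → (F (n + p) ↔ F n))
    (hG : ∀ n, n0 ≤ n → (G (n + p) ↔ G n)) (n : ℕ) (hn : n0 + p ≤ n) :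
    sS F G (n + p) ↔ sS F G n := by
  constructor
  · rintro ⟨j, h1, h2, h3⟩
    by_cases hj : n0 + p ≤ j
    · refine ⟨j - p, by omega, ?_, fun m h4 h5 => ?_⟩
      · rw [← hG _ (by omega), show j - p + p = j by omega]; exact h2
      · rw [← hF _ (by omega)]; exact h3 _ (by omega) (by omega)
    · exact ⟨j, by omega, h2, fun m h4 h5 => h3 m h4 (by omega)⟩
  · rintro ⟨j, h1, h2, h3⟩
    by_cases hj : n0 ≤ j
    · refine ⟨j + p, by omega, (hG _ hj).2 h2, fun m h4 h5 => ?_⟩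
      have := (hF (m - p) (by omega)).2 (h3 _ (by omega) (by omega))
      rwa [show m - p + p = m by omega] at this
    · have hall := per_all hp hF n0 le_rfl (fun m h4 h5 => h3 m (by omega) (by omega))
      refine ⟨j, by omega, h2, fun m h4 h5 => ?_⟩
      by_cases hm : m ≤ n
      · exact h3 m h4 hm
      · exact hall m (by omega)

lemma sat_per (L : S → Set AP) {π : ℕ → S} {l p : ℕ} (hp : 0 < p)
    (hπ : ∀ i, l ≤ i → π (i + p) = π i) (φ : PLTL AP) :
    ∀ n, l + φ.delta * p ≤ n → (PLTL.sat L π φ (n + p) ↔ PLTL.sat L π φ n) := by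
  have mono : ∀ {x y : ℕ}, x ≤ y → x * p ≤ y * p := fun h => Nat.mul_le_mul_right p h
  induction φ with
  | atom a => intro n hn; simp only [PLTL.sat, hπ n (by omega)]
  | natom a => intro n hn; simp only [PLTL.sat, hπ n (by omega)]
  | conj f g hf hg =>
    intro n hn
    rw [PLTL.delta] at hn
    have h1 := mono (le_max_left f.delta g.delta)
    have h2 := mono (le_max_right f.delta g.delta)
    simp only [PLTL.sat, hf n (by omega), hg n (by omega)]
  | disj f g hf hg =>
    intro n hn
    rw [PLTL.delta] at hn
    have h1 := mono (le_max_left f.delta g.delta)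
    have h2 := mono (le_max_right f.delta g.delta)
    simp only [PLTL.sat, hf n (by omega), hg n (by omega)]
  | next f hf =>
    intro n hn
    rw [PLTL.delta] at hn
    rw [sat_next, sat_next, ← hf (n + 1) (by omega), show n + p + 1 = n + 1 + p by omega]
  | untl f g hf hg =>
    intro n hn
    rw [PLTL.delta] at hn
    have h1 := mono (le_max_left f.delta g.delta)
    have h2 := mono (le_max_right f.delta g.delta)
    exact sU_per (fun n hn => hf n (by omega)) (fun n hn => hg n (by omega)) n hn
  | rels f g hf hg =>
    intro n hn
    rw [PLTL.delta] at hn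
    have h1 := mono (le_max_left f.delta g.delta)
    have h2 := mono (le_max_right f.delta g.delta)
    rw [sat_rels, sat_rels, sR_iff, sR_iff]
    exact not_congr (sU_per (fun n hn => not_congr (hf n (by omega)))
      (fun n hn => not_congr (hg n (by omega))) n hn)
  | prev f hf =>
    intro n hn
    rw [PLTL.delta, Nat.succ_mul] at hn
    obtain ⟨m, rfl⟩ : ∃ m, n = m + 1 := ⟨n - 1, by omega⟩
    rw [show m + 1 + p = m + p + 1 by omega, sat_prev_succ, sat_prev_succ, hf m (by omega)]
  | wprev f hf =>
    intro n hn
    rw [PLTL.delta, Nat.succ_mul] at hn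
    obtain ⟨m, rfl⟩ : ∃ m, n = m + 1 := ⟨n - 1, by omega⟩
    rw [show m + 1 + p = m + p + 1 by omega, sat_wprev_succ, sat_wprev_succ, hf m (by omega)]
  | since f g hf hg =>
    intro n hn
    rw [PLTL.delta, Nat.succ_mul] at hn
    have h1 := mono (le_max_left f.delta g.delta)
    have h2 := mono (le_max_right f.delta g.delta)
    exact sS_per hp (n0 := l + max f.delta g.delta * p)
      (fun n hn => hf n (by omega)) (fun n hn => hg n (by omega)) n (by omega)
  | trig f g hf hg =>
    intro n hn
    rw [PLTL.delta, Nat.succ_mul] at hn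
    have h1 := mono (le_max_left f.delta g.delta)
    have h2 := mono (le_max_right f.delta g.delta)
    rw [sat_trig, sat_trig, sT_iff, sT_iff]
    exact not_congr (sS_per hp (n0 := l + max f.delta g.delta * p)
      (fun n hn => not_congr (hf n (by omega)))
      (fun n hn => not_congr (hg n (by omega))) n (by omega))

lemma sat_stab (L : S → Set AP) {π : ℕ → S} {l p : ℕ} (hp : 0 < p)
    (hπ : ∀ i, l ≤ i → π (i + p) = π i) (φ : PLTL AP) (i : ℕ) (hi : l ≤ i) (d : ℕ) :
    PLTL.sat L π φ (i + (min d φ.delta) * p) ↔ PLTL.sat L π φ (i + d * p) := by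
  by_cases h : d ≤ φ.delta
  · rw [min_eq_left h]
  · rw [min_eq_right (by omega)]
    have : ∀ t, PLTL.sat L π φ (i + φ.delta * p) ↔ PLTL.sat L π φ (i + (φ.delta + t) * p) := by
      intro t
      induction t with
      | zero => rfl
      | succ t ih =>
        rw [ih, ← sat_per L hp hπ φ (i + (φ.delta + t) * p)]
        · rw [← Nat.add_assoc φ.delta, Nat.succ_mul, Nat.add_assoc]
        · have := Nat.mul_le_mul_right p (Nat.le_add_right φ.delta t)
          omega
    have := this (d - φ.delta)
    rwa [show φ.delta + (d - φ.delta) = d by omega] at this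

end BMC
namespace BMC

variable {AP S : Type}

def caux (L : S → Set AP) (π : ℕ → S) (l p : ℕ) : PLTL AP → ℕ → Prop
  | .untl _ g, n => ∃ m, l ≤ m ∧ m ≤ n ∧ PLTL.sat L π g (m + g.delta * p)
  | .rels _ g, n => ∀ m, l ≤ m → m ≤ n → PLTL.sat L π g (m + g.delta * p)
  | _, _ => True

lemma loop_wit (L : S → Set AP) {π : ℕ → S} {l p k : ℕ} (hp : 0 < p) (hk : k + 1 = l + p)
    (hπ : ∀ i, l ≤ i → π (i + p) = π i) (g : PLTL AP) (D : ℕ) (hD : g.delta ≤ D)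
    (j : ℕ) (hj : k + D * p ≤ j) :
    ∃ m, l ≤ m ∧ m ≤ k ∧ (PLTL.sat L π g j ↔ PLTL.sat L π g (m + g.delta * p)) := by
  have h1 := dd_ii l p j
  have h2 := ii_lt (l := l) hp j
  have h3 := lt_or_le_ii (l := l) (p := p) j
  have h4 : D ≤ dd l p j := Nat.le_of_mul_le_mul_right (by omega : D * p ≤ dd l p j * p) hp
  have h5 : l ≤ ii l p j := by
    rcases h3 with h3 | h3
    · omega
    · exact h3
  refine ⟨ii l p j, h5, by omega, ?_⟩
  have := sat_stab L hp hπ g (ii l p j) h5 (dd l p j)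
  rw [min_eq_right (by omega), ← h1] at this
  exact this.symm

lemma caux_untl (L : S → Set AP) {π : ℕ → S} {l p k : ℕ} (hp : 0 < p) (hk : k + 1 = l + p)
    (hπ : ∀ i, l ≤ i → π (i + p) = π i) (f g : PLTL AP)
    (h : PLTL.sat L π (.untl f g) (k + (PLTL.untl f g).delta * p)) :
    caux L π l p (.untl f g) k := by
  obtain ⟨j, h1, h2, -⟩ := h
  obtain ⟨m, h3, h4, h5⟩ := loop_wit L hp hk hπ g _ (le_max_right f.delta g.delta) j h1
  exact ⟨m, h3, h4, h5.1 h2⟩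

lemma caux_rels (L : S → Set AP) {π : ℕ → S} {l p k : ℕ} (hp : 0 < p) (hk : k + 1 = l + p)
    (hπ : ∀ i, l ≤ i → π (i + p) = π i) (f g : PLTL AP)
    (h : caux L π l p (.rels f g) k) :
    PLTL.sat L π (.rels f g) (k + (PLTL.rels f g).delta * p) := by
  intro j h1
  obtain ⟨m, h3, h4, h5⟩ := loop_wit L hp hk hπ g _ (le_max_right f.delta g.delta) j h1
  exact Or.inl (h5.2 (h m h3 h4))

lemma cutA {M : Kripke S AP} {π : ℕ → S} (hπ : M.InitPath π) {χ : PLTL AP}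
    (hs : PLTL.sat M.L π χ 0) {k l : ℕ} (hl : IsKLoop π k l) {i j : ℕ} (hij : i < j) (hj : j < l)
    (hT : SameT M.L π χ i j) : LW M χ (k - (j - i)) := by
  obtain ⟨h1, h2, h3, h4⟩ := hl
  have H : Remap M.L π χ (fun n => if n ≤ i then n else n + (j - i)) := by
    refine ⟨by simp, fun n => ?_, fun φ hφ n => ?_⟩
    · dsimp only
      rcases lt_trichotomy n i with h | h | h
      · refine ⟨n, by rw [if_pos (by omega)], ?_⟩
        rw [if_pos (by omega)]
        exact ⟨rfl, fun _ _ => Iff.rfl⟩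
      · subst h
        refine ⟨j, by rw [if_neg (by omega)]; omega, ?_⟩
        rw [if_pos le_rfl]
        exact ⟨hT.1.symm, fun φ hφ => (hT.2 φ hφ).symm⟩
      · refine ⟨n + (j - i), by rw [if_neg (by omega)]; omega, ?_⟩
        rw [if_neg (by omega)]
        exact ⟨rfl, fun _ _ => Iff.rfl⟩
    · obtain ⟨m, hm, hg⟩ := good_ex M.L π φ (n + j + 1)
      refine ⟨m - (j - i), by omega, ?_⟩
      dsimp only
      rw [if_neg (by omega), show m - (j - i) + (j - i) = m by omega]
      exact hg
  refine remap_LW hπ H hs (l := l - (j - i)) ⟨by omega, by omega, ?_, fun n hn => ?_⟩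
  · dsimp only
    rw [if_neg (show ¬ k - (j - i) ≤ i by omega), show k - (j - i) + (j - i) = k by omega, ← h3]
    by_cases h : l - (j - i) - 1 ≤ i
    · rw [if_pos h, show l - (j - i) - 1 = i by omega, show l - 1 = j by omega]
      exact hT.1
    · rw [if_neg h]; congr 1; omega
  · dsimp only
    rw [if_neg (by omega), if_neg (by omega), ← h4 (n + (j - i)) (by omega)]
    congr 1; omega

lemma cutB {M : Kripke S AP} {π : ℕ → S} (hπ : M.InitPath π) {χ : PLTL AP}
    (hs : PLTL.sat M.L π χ 0) {k l : ℕ} (hl : IsKLoop π k l) {i j : ℕ} (hi : l ≤ i) (hij : i < j)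
    (hj : j ≤ k) (hst : π i = π j)
    (hv : ∀ φ ∈ χ.subfs, ∀ d, d ≤ φ.delta → (PLTL.sat M.L π φ (i + d * (k + 1 - l)) ↔
      PLTL.sat M.L π φ (j + d * (k + 1 - l))))
    (ha : ∀ φ ∈ χ.subfs, φ.isUR →
      (caux M.L π l (k + 1 - l) φ i ↔ caux M.L π l (k + 1 - l) φ j)) :
    LW M χ (k - (j - i)) := by
  obtain ⟨h1, h2, h3, h4⟩ := hl
  obtain ⟨p, hp⟩ : ∃ p, p = k + 1 - l := ⟨_, rfl⟩
  rw [← hp] at hv ha h4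
  have hp0 : 0 < p := by omega
  have hk : k + 1 = l + p := by omega
  obtain ⟨c, hc⟩ : ∃ c, c = j - i := ⟨_, rfl⟩
  obtain ⟨p', hp'⟩ : ∃ p', p' = p - c := ⟨_, rfl⟩
  have hp0' : 0 < p' := by omega
  have hper : ∀ t n, l ≤ n → π (n + t * p) = π n := by
    intro t
    induction t with
    | zero => intro n _; simp
    | succ t ih => intro n hn; rw [Nat.succ_mul, ← Nat.add_assoc, h4 _ (by omega), ih n hn]
  have hT : ∀ d, SameT M.L π χ (j + d * p) (i + d * p) := by
    intro d
    refine ⟨by rw [hper _ _ hi, hper _ _ (by omega), hst], fun φ hφ => ?_⟩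
    rw [← sat_stab M.L hp0 h4 φ i hi, ← sat_stab M.L hp0 h4 φ j (by omega)]
    exact (hv φ hφ _ (min_le_right _ _)).symm
  have hret : ∀ φ ∈ χ.subfs, ∃ m, l ≤ m ∧ m ≤ k ∧ (m ≤ i ∨ j < m) ∧
      ∀ d, φ.delta ≤ d → good M.L π φ (m + d * p) := by
    intro φ hφ
    cases φ with
    | untl f g =>
      by_cases hu : PLTL.sat M.L π (.untl f g) (k + (PLTL.untl f g).delta * p)
      · have hd : g.delta ≤ (PLTL.untl f g).delta := le_max_right _ _
        have : ∃ m, l ≤ m ∧ m ≤ k ∧ (m ≤ i ∨ j < m) ∧ PLTL.sat M.L π g (m + g.delta * p) := by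
          obtain ⟨m, q1, q2, q3⟩ := caux_untl M.L hp0 hk h4 f g hu
          by_cases hm : j < m
          · exact ⟨m, q1, q2, Or.inr hm, q3⟩
          · obtain ⟨m', q4, q5, q6⟩ := (ha _ hφ trivial).2 ⟨m, q1, by omega, q3⟩
            exact ⟨m', q4, by omega, Or.inl q5, q6⟩
        obtain ⟨m, q1, q2, q3, q4⟩ := this
        refine ⟨m, q1, q2, q3, fun d hd' => Or.inr ?_⟩
        rw [← sat_stab M.L hp0 h4 g m q1, min_eq_right (by omega)]
        exact q4
      · have hn : ∀ d, (PLTL.untl f g).delta ≤ d → ¬ PLTL.sat M.L π (.untl f g) (k + d * p) := by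
          intro d hd
          rw [← sat_stab M.L hp0 h4 _ k h2, min_eq_right hd]; exact hu
        by_cases hjk : j = k
        · refine ⟨i, hi, by omega, Or.inl le_rfl, fun d hd => Or.inl ?_⟩
          rw [← (hT d).2 _ hφ, hjk]; exact hn d hd
        · exact ⟨k, h2, le_rfl, Or.inr (by omega), fun d hd => Or.inl (hn d hd)⟩
    | rels f g =>
      by_cases hu : PLTL.sat M.L π (.rels f g) (k + (PLTL.rels f g).delta * p)
      · have hn : ∀ d, (PLTL.rels f g).delta ≤ d → PLTL.sat M.L π (.rels f g) (k + d * p) := by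
          intro d hd
          rw [← sat_stab M.L hp0 h4 _ k h2, min_eq_right hd]; exact hu
        by_cases hjk : j = k
        · refine ⟨i, hi, by omega, Or.inl le_rfl, fun d hd => Or.inl ?_⟩
          rw [← (hT d).2 _ hφ, hjk]; exact hn d hd
        · exact ⟨k, h2, le_rfl, Or.inr (by omega), fun d hd => Or.inl (hn d hd)⟩
      · have hd : g.delta ≤ (PLTL.rels f g).delta := le_max_right _ _
        have : ∃ m, l ≤ m ∧ m ≤ k ∧ (m ≤ i ∨ j < m) ∧ ¬ PLTL.sat M.L π g (m + g.delta * p) := by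
          by_contra hcon
          push Not at hcon
          apply hu
          apply caux_rels M.L hp0 hk h4 f g
          have hi' : caux M.L π l p (.rels f g) i :=
            fun m q1 q2 => hcon m q1 (by omega) (Or.inl q2)
          have hj' := (ha _ hφ trivial).1 hi'
          intro m q1 q2
          by_cases hm : j < m
          · exact hcon m q1 q2 (Or.inr hm)
          · exact hj' m q1 (by omega)
        obtain ⟨m, q1, q2, q3, q4⟩ := this
        refine ⟨m, q1, q2, q3, fun d hd' => Or.inr ?_⟩
        rw [← sat_stab M.L hp0 h4 g m q1, min_eq_right (by omega)]
        exact q4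
    | _ => exact ⟨i, hi, by omega, Or.inl le_rfl, fun _ _ => trivial⟩
  have H : Remap M.L π χ (fun n => (if ii l p' n ≤ i then ii l p' n else ii l p' n + c) +
      dd l p' n * p) := by
    refine ⟨?_, fun n => ?_, fun φ hφ n => ?_⟩
    · obtain ⟨q1, q2⟩ := dd_ii_pre (l := l) (p := p') 0 h1
      simp [q1, q2]
    · dsimp only
      rcases dd_ii_step (l := l) hp0' n with ⟨q1, q2, q3⟩ | ⟨q1, q2, q3⟩
      · rw [q2, q3]
        rcases lt_trichotomy (ii l p' n) i with h | h | h
        · rw [if_pos (by omega), if_pos (by omega)]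
          exact ⟨ii l p' n + dd l p' n * p, by omega, rfl, fun _ _ => Iff.rfl⟩
        · rw [if_neg (by omega), if_pos (by omega), h]
          exact ⟨j + dd l p' n * p, by omega, hT _⟩
        · rw [if_neg (by omega), if_neg (by omega)]
          exact ⟨ii l p' n + c + dd l p' n * p, by omega, rfl, fun _ _ => Iff.rfl⟩
      · rw [q2, q3, if_pos hi, Nat.succ_mul]
        by_cases h : ii l p' n ≤ i
        · rw [if_pos h, show ii l p' n = i by omega]
          refine ⟨j + dd l p' n * p, by omega, hT _⟩
        · rw [if_neg h]
          exact ⟨ii l p' n + c + dd l p' n * p, by omega, rfl, fun _ _ => Iff.rfl⟩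
    · obtain ⟨m, q1, q2, q3, q4⟩ := hret φ hφ
      have hle := Nat.le_mul_of_pos_right (n + φ.delta) hp0'
      rcases q3 with q3 | q3
      · obtain ⟨r1, r2⟩ := dd_ii_loop (l := l) (p := p') m (n + φ.delta) q1 (by omega)
        refine ⟨m + (n + φ.delta) * p', by omega, ?_⟩
        dsimp only
        rw [r1, r2, if_pos q3]
        exact q4 _ (by omega)
      · obtain ⟨r1, r2⟩ := dd_ii_loop (l := l) (p := p') (m - c) (n + φ.delta) (by omega) (by omega)
        refine ⟨m - c + (n + φ.delta) * p', by omega, ?_⟩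
        dsimp only
        rw [r1, r2, if_neg (by omega), show m - c + c = m by omega]
        exact q4 _ (by omega)
  rw [← hc]
  refine remap_LW hπ H hs (l := l) ⟨by omega, by omega, ?_, fun n hn => ?_⟩
  · obtain ⟨q1, q2⟩ := dd_ii_pre (l := l) (p := p') (l - 1) (by omega)
    obtain ⟨r1, r2⟩ := dd_ii_loop (l := l) (p := p') (k - c) 0 (by omega) (by omega)
    rw [Nat.zero_mul, Nat.add_zero] at r1 r2
    dsimp only
    rw [q1, q2, r1, r2, if_pos (by omega), Nat.zero_mul, Nat.add_zero, Nat.add_zero, h3]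
    by_cases h : k - c ≤ i
    · rw [if_pos h, show k - c = i by omega, hst]; congr 1; omega
    · rw [if_neg h]; congr 1; omega
  · have g0 := lt_or_le_ii (l := l) (p := p') n
    have g2 := dd_ii l p' n
    have g3 := ii_lt (l := l) hp0' n
    have g4 := dd_ii_loop (l := l) (p := p') (ii l p' n) (dd l p' n + 1) (by omega) g3
    rw [Nat.succ_mul, ← Nat.add_assoc, ← g2] at g4
    dsimp only
    rw [show k - c + 1 - l = p' by omega, g4.1, g4.2, Nat.succ_mul, ← Nat.add_assoc]
    apply h4
    split <;> omega

end BMC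
namespace BMC

variable {AP S : Type}

def recB (l : ℕ) (step : ℕ → Prop → Prop) (b : Prop) (i : ℕ) : Prop :=
  Nat.rec (motive := fun _ => Prop) b (fun n r => step (l - (n + 1)) r) (l - i)

lemma recB_lt (l : ℕ) (step : ℕ → Prop → Prop) (b : Prop) (i : ℕ) (h : i < l) :
    recB l step b i = step i (recB l step b (i + 1)) := by
  unfold recB
  obtain ⟨m, hm⟩ : ∃ m, l - i = m + 1 := ⟨l - i - 1, by omega⟩
  rw [hm, show l - (i + 1) = m by omega]
  show step (l - (m + 1)) _ = _
  rw [show l - (m + 1) = i by omega]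

lemma recB_self (l : ℕ) (step : ℕ → Prop → Prop) (b : Prop) : recB l step b l = b := by
  unfold recB
  rw [Nat.sub_self]
  rfl

def recF (step : ℕ → Prop → Prop) (b : Prop) (i : ℕ) : Prop :=
  Nat.rec (motive := fun _ => Prop) b (fun n r => step (n + 1) r) i

def sel (l p : ℕ) (σ : ℕ → Prop) (G : ℕ → ℕ → Prop) (d i : ℕ) : Prop :=
  if l ≤ i ∨ d = 0 then σ (i + d * p) else G d i

def cG (L : S → Set AP) (π : ℕ → S) (l p : ℕ) : PLTL AP → ℕ → ℕ → Prop
  | .atom _, _, _ => True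
  | .natom _, _, _ => True
  | .conj f g, d, i => sel l p (PLTL.sat L π f) (cG L π l p f) (min d f.delta) i ∧
      sel l p (PLTL.sat L π g) (cG L π l p g) (min d g.delta) i
  | .disj f g, d, i => sel l p (PLTL.sat L π f) (cG L π l p f) (min d f.delta) i ∨
      sel l p (PLTL.sat L π g) (cG L π l p g) (min d g.delta) i
  | .next f, d, i => sel l p (PLTL.sat L π f) (cG L π l p f) (min d f.delta) (i + 1)
  | .untl f g, d, i => recB l (fun n r =>
      sel l p (PLTL.sat L π g) (cG L π l p g) (min d g.delta) n ∨
      (sel l p (PLTL.sat L π f) (cG L π l p f) (min d f.delta) n ∧ r))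
      (PLTL.sat L π (.untl f g) (l + d * p)) i
  | .rels f g, d, i => recB l (fun n r =>
      sel l p (PLTL.sat L π g) (cG L π l p g) (min d g.delta) n ∧
      (sel l p (PLTL.sat L π f) (cG L π l p f) (min d f.delta) n ∨ r))
      (PLTL.sat L π (.rels f g) (l + d * p)) i
  | .prev f, d, i => i ≠ 0 ∧ sel l p (PLTL.sat L π f) (cG L π l p f) (min d f.delta) (i - 1)
  | .wprev f, d, i => i = 0 ∨ sel l p (PLTL.sat L π f) (cG L π l p f) (min d f.delta) (i - 1)
  | .since f g, d, i => recF (fun n r =>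
      sel l p (PLTL.sat L π g) (cG L π l p g) (min d g.delta) n ∨
      (sel l p (PLTL.sat L π f) (cG L π l p f) (min d f.delta) n ∧ r))
      (sel l p (PLTL.sat L π g) (cG L π l p g) (min d g.delta) 0) i
  | .trig f g, d, i => recF (fun n r =>
      sel l p (PLTL.sat L π g) (cG L π l p g) (min d g.delta) n ∧
      (sel l p (PLTL.sat L π f) (cG L π l p f) (min d f.delta) n ∨ r))
      (sel l p (PLTL.sat L π g) (cG L π l p g) (min d g.delta) 0) i

def cV (L : S → Set AP) (π : ℕ → S) (l p : ℕ) (φ : PLTL AP) (d i : ℕ) : Prop :=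
  sel l p (PLTL.sat L π φ) (cG L π l p φ) d i

section canon
variable {L : S → Set AP} {π : ℕ → S} {l p k : ℕ}

lemma cV_zero (φ : PLTL AP) (i : ℕ) : cV L π l p φ 0 i ↔ PLTL.sat L π φ i := by
  simp [cV, sel]

lemma cV_loop (φ : PLTL AP) (d i : ℕ) (h : l ≤ i) :
    cV L π l p φ d i ↔ PLTL.sat L π φ (i + d * p) := by
  simp [cV, sel, h]

lemma cV_pre (φ : PLTL AP) (d i : ℕ) (h : i < l) (hd : d ≠ 0) :
    cV L π l p φ d i ↔ cG L π l p φ d i := by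
  simp [cV, sel, h, hd]

lemma pV_zero (φ : PLTL AP) (i : ℕ) : pV (cV L π l p) φ 0 i ↔ PLTL.sat L π φ i := by
  unfold pV; rw [Nat.zero_min, cV_zero]

lemma pV_loop (hp : 0 < p) (hπ : ∀ i, l ≤ i → π (i + p) = π i)
    (φ : PLTL AP) (d i : ℕ) (h : l ≤ i) :
    pV (cV L π l p) φ d i ↔ PLTL.sat L π φ (i + d * p) := by
  unfold pV; rw [cV_loop _ _ _ h, sat_stab L hp hπ φ i h d]

def cE (L : S → Set AP) (π : ℕ → S) (k p : ℕ) (φ : PLTL AP) (d : ℕ) : Prop :=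
  PLTL.sat L π φ (k + d * p)

lemma pW_cE (hp : 0 < p) (hk : l ≤ k) (hπ : ∀ i, l ≤ i → π (i + p) = π i)
    (φ : PLTL AP) (d : ℕ) :
    pW (cE L π k p) φ d ↔ PLTL.sat L π φ (k + d * p) := by
  unfold pW cE; rw [sat_stab L hp hπ φ k hk d]

lemma c_last (hp : 0 < p) (hk : k + 1 = l + p) (hπ : ∀ i, l ≤ i → π (i + p) = π i)
    (φ : PLTL AP) :
    incLastC true k (fun i => i = l) True (cV L π l p) (cE L π k p) (cE L π l p) φ := by
  intro d hd
  refine ⟨fun h => absurd trivial h, ?_, ?_, ?_⟩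
  · rintro i h1 h2 rfl
    rw [cV_loop _ _ _ le_rfl]; rfl
  · intro _
    rw [cV_loop _ _ _ (by omega)]; rfl
  · intro _
    rw [cV_loop _ _ _ (by omega), pW_cE hp le_rfl hπ, Nat.succ_mul]
    rw [show k + 1 + d * p = l + (d * p + p) by omega]

/-- past step inside the loop -/
lemma past_arith {d i : ℕ} (hk : k + 1 = l + p) (hd : 1 ≤ d) :
    (i = l → i + d * p = k + (d - 1) * p + 1) := by
  intro h
  obtain ⟨e, rfl⟩ : ∃ e, d = e + 1 := ⟨d - 1, by omega⟩
  rw [Nat.succ_mul, Nat.add_sub_cancel]; omega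

theorem canon_pinc (hl : 0 < l) (hp : 0 < p) (hk : k + 1 = l + p)
    (hπ : ∀ i, l ≤ i → π (i + p) = π i) (φ : PLTL AP) :
    pincC true k L π (fun i => i = l) (fun i => l ≤ i) True (cV L π l p) (cE L π k p)
      (cE L π l p) (caux L π l p) (fun φ => caux L π l p φ k) φ := by
  have hlk : l ≤ k := by omega
  induction φ with
  | atom a => exact ⟨fun i _ => cV_zero _ _, c_last hp hk hπ _⟩
  | natom a => exact ⟨fun i _ => cV_zero _ _, c_last hp hk hπ _⟩
  | conj f g hf hg =>
    refine ⟨hf, hg, fun d _ i hi => ?_, c_last hp hk hπ _⟩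
    by_cases h1 : l ≤ i
    · rw [pV_loop hp hπ _ _ _ h1, pV_loop hp hπ _ _ _ h1, cV_loop _ _ _ h1]; rfl
    · by_cases h2 : d = 0
      · subst h2; rw [pV_zero, pV_zero, cV_zero]; rfl
      · rw [cV_pre _ _ _ (by omega) h2]; rfl
  | disj f g hf hg =>
    refine ⟨hf, hg, fun d _ i hi => ?_, c_last hp hk hπ _⟩
    by_cases h1 : l ≤ i
    · rw [pV_loop hp hπ _ _ _ h1, pV_loop hp hπ _ _ _ h1, cV_loop _ _ _ h1]; rfl
    · by_cases h2 : d = 0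
      · subst h2; rw [pV_zero, pV_zero, cV_zero]; rfl
      · rw [cV_pre _ _ _ (by omega) h2]; rfl
  | next f hf =>
    refine ⟨hf, fun d _ i hi => ?_, c_last hp hk hπ _⟩
    by_cases h1 : l ≤ i
    · rw [pV_loop hp hπ _ _ _ (by omega), cV_loop _ _ _ h1, sat_next,
        show i + d * p + 1 = i + 1 + d * p by omega]
    · by_cases h2 : d = 0
      · subst h2; rw [pV_zero, cV_zero]; rfl
      · rw [cV_pre _ _ _ (by omega) h2]; rfl
  | untl f g hf hg =>
    refine ⟨hf, hg, fun d _ i hi => ?_, c_last hp hk hπ _, ?_, fun i h1 h2 => ?_, fun _ h => ?_,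
      fun _ => Iff.rfl⟩
    · by_cases h1 : l ≤ i
      · rw [pV_loop hp hπ _ _ _ h1, pV_loop hp hπ _ _ _ h1, cV_loop _ _ _ h1,
          cV_loop _ _ _ (by omega), sat_untl, sU_step,
          show i + d * p + 1 = i + 1 + d * p by omega]; rfl
      · by_cases h2 : d = 0
        · subst h2; rw [pV_zero, pV_zero, cV_zero, cV_zero, sat_untl, sU_step]; rfl
        · rw [cV_pre _ _ _ (by omega) h2, cG, recB_lt _ _ _ _ (by omega)]
          by_cases h3 : i + 1 < l
          · rw [cV_pre _ _ _ h3 h2]; rfl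
          · rw [show i + 1 = l by omega, cV_loop _ _ _ le_rfl, recB_self]; rfl
    · rintro ⟨m, h1, h2, -⟩; omega
    · constructor
      · rintro ⟨m, q1, q2, q3⟩
        by_cases hm : m = i
        · subst hm
          exact Or.inr ⟨q1, (cV_loop _ _ _ q1).2 q3⟩
        · exact Or.inl ⟨m, q1, by omega, q3⟩
      · rintro (⟨m, q1, q2, q3⟩ | ⟨q1, q2⟩)
        · exact ⟨m, q1, by omega, q3⟩
        · exact ⟨i, q1, le_rfl, (cV_loop _ _ _ q1).1 q2⟩
    · exact caux_untl L hp hk hπ f g h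
  | rels f g hf hg =>
    refine ⟨hf, hg, fun d _ i hi => ?_, c_last hp hk hπ _, ?_, fun i h1 h2 => ?_, fun _ h => ?_,
      fun _ => Iff.rfl⟩
    · by_cases h1 : l ≤ i
      · rw [pV_loop hp hπ _ _ _ h1, pV_loop hp hπ _ _ _ h1, cV_loop _ _ _ h1,
          cV_loop _ _ _ (by omega), sat_rels, sR_step,
          show i + d * p + 1 = i + 1 + d * p by omega]; rfl
      · by_cases h2 : d = 0
        · subst h2; rw [pV_zero, pV_zero, cV_zero, cV_zero, sat_rels, sR_step]; rfl
        · rw [cV_pre _ _ _ (by omega) h2, cG, recB_lt _ _ _ _ (by omega)]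
          by_cases h3 : i + 1 < l
          · rw [cV_pre _ _ _ h3 h2]; rfl
          · rw [show i + 1 = l by omega, cV_loop _ _ _ le_rfl, recB_self]; rfl
    · intro m h1 h2; omega
    · constructor
      · intro q
        refine ⟨fun m q1 q2 => q m q1 (by omega), ?_⟩
        by_cases hi : l ≤ i
        · exact Or.inr ((cV_loop _ _ _ hi).2 (q i hi le_rfl))
        · exact Or.inl hi
      · rintro ⟨q1, q2⟩ m q3 q4
        by_cases hm : m = i
        · subst hm
          exact (cV_loop _ _ _ q3).1 (q2.resolve_left (fun h => h q3))
        · exact q1 m q3 (by omega)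
    · exact caux_rels L hp hk hπ f g h
  | prev f hf =>
    refine ⟨hf, fun d _ => ?_, fun i h1 _ => ?_, fun d hd _ i h1 h2 => ?_, c_last hp hk hπ _⟩
    · by_cases h2 : d = 0
      · subst h2; rw [cV_zero]; exact sat_prev_zero _ _ _
      · rw [cV_pre _ _ _ hl h2]; exact fun h => h.1 rfl
    · obtain ⟨m, rfl⟩ : ∃ m, i = m + 1 := ⟨i - 1, by omega⟩
      rw [cV_zero, pV_zero, sat_prev_succ, Nat.add_sub_cancel]
    · rcases lt_trichotomy i l with h | h | h
      · rw [cV_pre _ _ _ h (by omega)]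
        constructor
        · intro q; exact Or.inr ⟨by omega, q.2⟩
        · rintro (q | q)
          · omega
          · exact ⟨by omega, q.2⟩
      · rw [cV_loop _ _ _ (by omega), pW_cE hp hlk hπ, past_arith hk hd h, sat_prev_succ]
        simp [h]
      · rw [cV_loop _ _ _ (by omega), pV_loop hp hπ _ _ _ (by omega),
          show i + d * p = i - 1 + d * p + 1 by omega, sat_prev_succ]
        simp [show i ≠ l by omega]
  | wprev f hf =>
    refine ⟨hf, fun d _ => ?_, fun i h1 _ => ?_, fun d hd _ i h1 h2 => ?_, c_last hp hk hπ _⟩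
    · by_cases h2 : d = 0
      · subst h2; rw [cV_zero]; exact sat_wprev_zero _ _ _
      · rw [cV_pre _ _ _ hl h2]; exact Or.inl rfl
    · obtain ⟨m, rfl⟩ : ∃ m, i = m + 1 := ⟨i - 1, by omega⟩
      rw [cV_zero, pV_zero, sat_wprev_succ, Nat.add_sub_cancel]
    · rcases lt_trichotomy i l with h | h | h
      · rw [cV_pre _ _ _ h (by omega)]
        constructor
        · intro q; exact Or.inr ⟨by omega, q.resolve_left (by omega)⟩
        · rintro (q | q)
          · omega
          · exact Or.inr q.2
      · rw [cV_loop _ _ _ (by omega), pW_cE hp hlk hπ, past_arith hk hd h, sat_wprev_succ]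
        simp [h]
      · rw [cV_loop _ _ _ (by omega), pV_loop hp hπ _ _ _ (by omega),
          show i + d * p = i - 1 + d * p + 1 by omega, sat_wprev_succ]
        simp [show i ≠ l by omega]
  | since f g hf hg =>
    refine ⟨hf, hg, fun d _ => ?_, fun i h1 _ => ?_, fun d hd _ i h1 h2 => ?_, c_last hp hk hπ _⟩
    · by_cases h2 : d = 0
      · subst h2; rw [cV_zero, pV_zero, sat_since, sS_zero]
      · rw [cV_pre _ _ _ hl h2]; rfl
    · obtain ⟨m, rfl⟩ : ∃ m, i = m + 1 := ⟨i - 1, by omega⟩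
      rw [cV_zero, cV_zero, pV_zero, pV_zero, sat_since, sS_succ, Nat.add_sub_cancel]; rfl
    · rcases lt_trichotomy i l with h | h | h
      · obtain ⟨m, rfl⟩ : ∃ m, i = m + 1 := ⟨i - 1, by omega⟩
        rw [Nat.add_sub_cancel, cV_pre _ _ _ h (by omega), cV_pre _ _ m (by omega) (by omega)]
        simp only [show m + 1 ≠ l by omega, false_and, false_or, not_false_eq_true, true_and]
        rfl
      · rw [cV_loop _ _ _ (by omega), pV_loop hp hπ _ _ _ (by omega),
          pV_loop hp hπ _ _ _ (by omega), past_arith hk hd h, sat_since, sS_succ]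
        simp only [h, true_and, not_true_eq_false, false_and, or_false]
        rfl
      · rw [cV_loop _ _ _ (by omega), pV_loop hp hπ _ _ _ (by omega),
          pV_loop hp hπ _ _ _ (by omega), cV_loop _ _ _ (by omega),
          show i + d * p = i - 1 + d * p + 1 by omega, sat_since, sS_succ]
        simp only [show i ≠ l by omega, false_and, false_or, not_false_eq_true, true_and]
        rfl
  | trig f g hf hg =>
    refine ⟨hf, hg, fun d _ => ?_, fun i h1 _ => ?_, fun d hd _ i h1 h2 => ?_, c_last hp hk hπ _⟩
    · by_cases h2 : d = 0
      · subst h2; rw [cV_zero, pV_zero, sat_trig, sT_zero]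
      · rw [cV_pre _ _ _ hl h2]; rfl
    · obtain ⟨m, rfl⟩ : ∃ m, i = m + 1 := ⟨i - 1, by omega⟩
      rw [cV_zero, cV_zero, pV_zero, pV_zero, sat_trig, sT_succ, Nat.add_sub_cancel]; rfl
    · rcases lt_trichotomy i l with h | h | h
      · obtain ⟨m, rfl⟩ : ∃ m, i = m + 1 := ⟨i - 1, by omega⟩
        rw [Nat.add_sub_cancel, cV_pre _ _ _ h (by omega), cV_pre _ _ m (by omega) (by omega)]
        simp only [show m + 1 ≠ l by omega, false_and, false_or, not_false_eq_true, true_and]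
        rfl
      · rw [cV_loop _ _ _ (by omega), pV_loop hp hπ _ _ _ (by omega),
          pV_loop hp hπ _ _ _ (by omega), past_arith hk hd h, sat_trig, sT_succ]
        simp only [h, true_and, not_true_eq_false, false_and, or_false]
        rfl
      · rw [cV_loop _ _ _ (by omega), pV_loop hp hπ _ _ _ (by omega),
          pV_loop hp hπ _ _ _ (by omega), cV_loop _ _ _ (by omega),
          show i + d * p = i - 1 + d * p + 1 by omega, sat_trig, sT_succ]
        simp only [show i ≠ l by omega, false_and, false_or, not_false_eq_true, true_and]
        rfl

end canon

lemma incLast_weak {k k' : ℕ} (hk : k ≤ k') {lsel : ℕ → Prop} {LE : Prop}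
    {v : PLTL AP → ℕ → ℕ → Prop} {vE vL : PLTL AP → ℕ → Prop} {φ : PLTL AP}
    (h : incLastC true k' lsel LE v vE vL φ) : incLastC false k lsel LE v vE vL φ := by
  intro d hd
  obtain ⟨h1, h2, -, -⟩ := h d hd
  exact ⟨h1, fun i a b => h2 i a (by omega), by simp, by simp⟩

lemma pinc_weak {k k' : ℕ} (hk : k ≤ k') {L : S → Set AP} {s : ℕ → S}
    {lsel inL : ℕ → Prop} {LE : Prop}
    {v : PLTL AP → ℕ → ℕ → Prop} {vE vL : PLTL AP → ℕ → Prop} {aux : PLTL AP → ℕ → Prop}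
    {auxE : PLTL AP → Prop} {φ : PLTL AP}
    (h : pincC true k' L s lsel inL LE v vE vL aux auxE φ) :
    pincC false k L s lsel inL LE v vE vL aux auxE φ := by
  induction φ with
  | atom a => exact ⟨fun i hi => h.1 i (by omega), incLast_weak hk h.2⟩
  | natom a => exact ⟨fun i hi => h.1 i (by omega), incLast_weak hk h.2⟩
  | conj f g hf hg =>
    obtain ⟨h1, h2, h3, h4⟩ := h
    exact ⟨hf h1, hg h2, fun d hd i hi => h3 d hd i (by omega), incLast_weak hk h4⟩
  | disj f g hf hg =>
    obtain ⟨h1, h2, h3, h4⟩ := h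
    exact ⟨hf h1, hg h2, fun d hd i hi => h3 d hd i (by omega), incLast_weak hk h4⟩
  | next f hf =>
    obtain ⟨h1, h3, h4⟩ := h
    exact ⟨hf h1, fun d hd i hi => h3 d hd i (by omega), incLast_weak hk h4⟩
  | untl f g hf hg =>
    obtain ⟨h1, h2, h3, h4, h5, h6, h7, -⟩ := h
    exact ⟨hf h1, hg h2, fun d hd i hi => h3 d hd i (by omega), incLast_weak hk h4, h5,
      fun i a b => h6 i a (by omega), h7, by simp⟩
  | rels f g hf hg =>
    obtain ⟨h1, h2, h3, h4, h5, h6, h7, -⟩ := h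
    exact ⟨hf h1, hg h2, fun d hd i hi => h3 d hd i (by omega), incLast_weak hk h4, h5,
      fun i a b => h6 i a (by omega), h7, by simp⟩
  | prev f hf =>
    obtain ⟨h1, h2, h3, h4, h5⟩ := h
    exact ⟨hf h1, h2, fun i a b => h3 i a (by omega),
      fun d a b i c e => h4 d a b i c (by omega), incLast_weak hk h5⟩
  | wprev f hf =>
    obtain ⟨h1, h2, h3, h4, h5⟩ := h
    exact ⟨hf h1, h2, fun i a b => h3 i a (by omega),
      fun d a b i c e => h4 d a b i c (by omega), incLast_weak hk h5⟩
  | since f g hf hg =>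
    obtain ⟨h0, h1, h2, h3, h4, h5⟩ := h
    exact ⟨hf h0, hg h1, h2, fun i a b => h3 i a (by omega),
      fun d a b i c e => h4 d a b i c (by omega), incLast_weak hk h5⟩
  | trig f g hf hg =>
    obtain ⟨h0, h1, h2, h3, h4, h5⟩ := h
    exact ⟨hf h0, hg h1, h2, fun i a b => h3 i a (by omega),
      fun d a b i c e => h4 d a b i c (by omega), incLast_weak hk h5⟩

lemma canon_loop {π : ℕ → S} {k l : ℕ} (hl : IsKLoop π k l) :
    incLoopC true k π (π k) (fun i => i = l) (fun i => l ≤ i) True := by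
  obtain ⟨h1, h2, h3, h4⟩ := hl
  refine ⟨by omega, by omega, ?_, ?_, ?_, ?_, fun _ => rfl⟩
  · rintro i _ _ rfl; exact h3
  · intro i _ _; omega
  · intro i _ _; omega
  · intro _; exact ⟨fun _ => h2, fun _ => trivial⟩

lemma LW_IncSat {M : Kripke S AP} {χ : PLTL AP} {k : ℕ} (h : LW M χ k) : IncSat M χ k := by
  obtain ⟨π, l, h1, h2, h3⟩ := h
  have h4 := h2
  obtain ⟨g1, g2, g3, g4⟩ := h4
  refine ⟨π, π k, _, _, True, cV M.L π l (k + 1 - l), _, _, _, _, ⟨h1.1, fun i a b => ?_⟩,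
    canon_loop h2, canon_pinc g1 (by omega) (by omega) g4 χ, (cV_zero _ _).2 h3⟩
  have := h1.2 (i - 1)
  rwa [Nat.sub_add_cancel a] at this

lemma LW_min_Compl {M : Kripke S AP} {χ : PLTL AP} {k k0 : ℕ} (h : LW M χ k0)
    (hmin : ∀ m, m < k0 → ¬ LW M χ m) (hk : k ≤ k0) : ComplSPSat M χ k := by
  obtain ⟨π, l, h1, h2, h3⟩ := h
  have h4 := h2
  obtain ⟨g1, g2, g3, g4⟩ := h4
  obtain ⟨q1, q2, q3, q4, q5, -, -⟩ := canon_loop h2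
  refine ⟨π, π k0, _, _, True, cV M.L π l (k0 + 1 - l), _, _, _, _, ⟨h1.1, fun i a b => ?_⟩,
    ⟨q1, q2, fun i a b => q3 i a (by omega), fun i a b => q4 i a (by omega),
      fun i a b => q5 i a (by omega), by simp, by simp⟩,
    pinc_weak hk (canon_pinc g1 (by omega) (by omega) g4 χ), (cV_zero _ _).2 h3, ?_⟩
  · have := h1.2 (i - 1)
    rwa [Nat.sub_add_cancel a] at this
  · intro i j hij hj
    by_contra hcon
    push Not at hcon
    obtain ⟨r1, r2, r3, r4⟩ := hcon
    by_cases hi : l ≤ i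
    · obtain ⟨r5, r6⟩ := r4 hi (by omega)
      refine hmin (k0 - (j - i)) (by omega) (cutB h1 h3 h2 hi hij (by omega) r1 ?_ ?_)
      · intro φ hφ d hd
        have := r5 φ hφ d hd
        rwa [cV_loop _ _ _ hi, cV_loop _ _ _ (by omega)] at this
      · exact r6
    · refine hmin (k0 - (j - i)) (by omega) (cutA h1 h3 h2 hij (by omega) ⟨r1, ?_⟩)
      intro φ hφ
      have := r3 φ hφ
      rwa [cV_zero, cV_zero] at this

end BMC
namespace BMC

variable {AP S : Type}

lemma extend_path {M : Kripke S AP} (hTot : M.Total) {k : ℕ} {s : ℕ → S} (h : ModelC M k s) :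
    ∃ π, M.InitPath π ∧ ∀ i, i ≤ k → π i = s i := by
  choose nx hnx using hTot
  refine ⟨fun n => nx^[n - k] (s (min n k)), ⟨?_, fun i => ?_⟩, fun i hi => ?_⟩
  · simpa using h.1
  · dsimp only
    by_cases hi : i + 1 ≤ k
    · rw [show i - k = 0 by omega, show i + 1 - k = 0 by omega, min_eq_left hi,
        min_eq_left (by omega)]
      exact h.2 (i + 1) (by omega) hi
    · rw [show i + 1 - k = (i - k) + 1 by omega, min_eq_right (by omega),
        min_eq_right (by omega), Function.iterate_succ_apply']
      exact hnx _
  · dsimp only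
    rw [show i - k = 0 by omega, min_eq_left hi]; rfl

lemma pV0 (v : PLTL AP → ℕ → ℕ → Prop) (φ : PLTL AP) (i : ℕ) : pV v φ 0 i = v φ 0 i := by
  unfold pV; rw [Nat.zero_min]

lemma last_false {k : ℕ} {lsel : ℕ → Prop} {LE : Prop} (hLE : ¬ LE)
    {v : PLTL AP → ℕ → ℕ → Prop} {vE vL : PLTL AP → ℕ → Prop} {φ : PLTL AP}
    (h : incLastC true k lsel LE v vE vL φ) : ¬ v φ 0 (k + 1) := by
  obtain ⟨-, -, -, h4⟩ := h 0 (Nat.zero_le _)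
  rw [h4 rfl]
  exact (h _ (min_le_right _ _)).1 hLE

lemma pinc_last {dep : Bool} {k : ℕ} {L : S → Set AP} {s : ℕ → S}
    {lsel inL : ℕ → Prop} {LE : Prop}
    {v : PLTL AP → ℕ → ℕ → Prop} {vE vL : PLTL AP → ℕ → Prop} {aux : PLTL AP → ℕ → Prop}
    {auxE : PLTL AP → Prop} {φ : PLTL AP}
    (h : pincC dep k L s lsel inL LE v vE vL aux auxE φ) :
    incLastC dep k lsel LE v vE vL φ := by
  cases φ with
  | atom a => exact h.2
  | natom a => exact h.2
  | conj f g => exact h.2.2.2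
  | disj f g => exact h.2.2.2
  | next f => exact h.2.2
  | untl f g => exact h.2.2.2.1
  | rels f g => exact h.2.2.2.1
  | prev f => exact h.2.2.2.2
  | wprev f => exact h.2.2.2.2
  | since f g => exact h.2.2.2.2.2
  | trig f g => exact h.2.2.2.2.2

lemma sound_noloop {k : ℕ} {L : S → Set AP} {s π : ℕ → S} (hπ : ∀ i, i ≤ k → π i = s i)
    {lsel inL : ℕ → Prop} {LE : Prop} (hLE : ¬ LE)
    {v : PLTL AP → ℕ → ℕ → Prop} {vE vL : PLTL AP → ℕ → Prop} {aux : PLTL AP → ℕ → Prop}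
    {auxE : PLTL AP → Prop} {φ : PLTL AP}
    (h : pincC true k L s lsel inL LE v vE vL aux auxE φ) :
    ∀ i, i ≤ k → v φ 0 i → PLTL.sat L π φ i := by
  have hlast := last_false hLE (pinc_last h)
  induction φ with
  | atom a => intro i hi hv; simp only [PLTL.sat, hπ i hi]; exact (h.1 i hi).1 hv
  | natom a => intro i hi hv; simp only [PLTL.sat, hπ i hi]; exact (h.1 i hi).1 hv
  | conj f g hf hg =>
    obtain ⟨h1, h2, h3, h4⟩ := h
    intro i hi hv
    rw [h3 0 (Nat.zero_le _) i hi, pV0, pV0] at hv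
    exact ⟨hf h1 (last_false hLE (pinc_last h1)) i hi hv.1,
      hg h2 (last_false hLE (pinc_last h2)) i hi hv.2⟩
  | disj f g hf hg =>
    obtain ⟨h1, h2, h3, h4⟩ := h
    intro i hi hv
    rw [h3 0 (Nat.zero_le _) i hi, pV0, pV0] at hv
    exact hv.imp (hf h1 (last_false hLE (pinc_last h1)) i hi)
      (hg h2 (last_false hLE (pinc_last h2)) i hi)
  | next f hf =>
    obtain ⟨h1, h3, h4⟩ := h
    intro i hi hv
    have hl := last_false hLE (pinc_last h1)
    rw [h3 0 (Nat.zero_le _) i hi, pV0] at hv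
    by_cases hik : i = k
    · subst hik; exact absurd hv hl
    · exact hf h1 hl (i + 1) (by omega) hv
  | untl f g hf hg =>
    obtain ⟨h1, h2, h3, h4, -⟩ := h
    have hf' := hf h1 (last_false hLE (pinc_last h1))
    have hg' := hg h2 (last_false hLE (pinc_last h2))
    have key : ∀ t i, i + t = k → v (.untl f g) 0 i → PLTL.sat L π (.untl f g) i := by
      intro t
      induction t with
      | zero =>
        intro i hi hv
        rw [h3 0 (Nat.zero_le _) i (by omega), pV0, pV0] at hv
        rw [sat_untl, sU_step]
        rcases hv with hv | hv
        · exact Or.inl (hg' i (by omega) hv)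
        · rw [show i = k by omega] at hv
          exact absurd hv.2 hlast
      | succ t ih =>
        intro i hi hv
        rw [h3 0 (Nat.zero_le _) i (by omega), pV0, pV0] at hv
        rw [sat_untl, sU_step]
        rcases hv with hv | hv
        · exact Or.inl (hg' i (by omega) hv)
        · exact Or.inr ⟨hf' i (by omega) hv.1, ih (i + 1) (by omega) hv.2⟩
    intro i hi hv
    exact key (k - i) i (by omega) hv
  | rels f g hf hg =>
    obtain ⟨h1, h2, h3, h4, -⟩ := h
    have hf' := hf h1 (last_false hLE (pinc_last h1))
    have hg' := hg h2 (last_false hLE (pinc_last h2))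
    have key : ∀ t i, i + t = k → v (.rels f g) 0 i → PLTL.sat L π (.rels f g) i := by
      intro t
      induction t with
      | zero =>
        intro i hi hv
        rw [h3 0 (Nat.zero_le _) i (by omega), pV0, pV0] at hv
        rw [sat_rels, sR_step]
        refine ⟨hg' i (by omega) hv.1, ?_⟩
        rcases hv.2 with hv | hv
        · exact Or.inl (hf' i (by omega) hv)
        · rw [show i = k by omega] at hv
          exact absurd hv hlast
      | succ t ih =>
        intro i hi hv
        rw [h3 0 (Nat.zero_le _) i (by omega), pV0, pV0] at hv
        rw [sat_rels, sR_step]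
        exact ⟨hg' i (by omega) hv.1, hv.2.imp (hf' i (by omega)) (ih (i + 1) (by omega))⟩
    intro i hi hv
    exact key (k - i) i (by omega) hv
  | prev f hf =>
    obtain ⟨h1, h2, h3, -⟩ := h
    have hf' := hf h1 (last_false hLE (pinc_last h1))
    intro i hi hv
    cases i with
    | zero => exact absurd hv (h2 0 (Nat.zero_le _))
    | succ i =>
      rw [h3 _ (by omega) hi, pV0, Nat.add_sub_cancel] at hv
      rw [sat_prev_succ]; exact hf' i (by omega) hv
  | wprev f hf =>
    obtain ⟨h1, h2, h3, -⟩ := h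
    have hf' := hf h1 (last_false hLE (pinc_last h1))
    intro i hi hv
    cases i with
    | zero => exact sat_wprev_zero _ _ _
    | succ i =>
      rw [h3 _ (by omega) hi, pV0, Nat.add_sub_cancel] at hv
      rw [sat_wprev_succ]; exact hf' i (by omega) hv
  | since f g hf hg =>
    obtain ⟨h0, h1, h2, h3, -⟩ := h
    have hf' := hf h0 (last_false hLE (pinc_last h0))
    have hg' := hg h1 (last_false hLE (pinc_last h1))
    intro i
    induction i with
    | zero =>
      intro hi hv
      rw [h2 0 (Nat.zero_le _), pV0] at hv
      rw [sat_since, sS_zero]; exact hg' 0 hi hv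
    | succ i ih =>
      intro hi hv
      rw [h3 _ (by omega) hi, pV0, pV0, Nat.add_sub_cancel] at hv
      rw [sat_since, sS_succ]
      exact hv.imp (hg' _ hi) (fun q => ⟨hf' _ hi q.1, ih (by omega) q.2⟩)
  | trig f g hf hg =>
    obtain ⟨h0, h1, h2, h3, -⟩ := h
    have hf' := hf h0 (last_false hLE (pinc_last h0))
    have hg' := hg h1 (last_false hLE (pinc_last h1))
    intro i
    induction i with
    | zero =>
      intro hi hv
      rw [h2 0 (Nat.zero_le _), pV0] at hv
      rw [sat_trig, sT_zero]; exact hg' 0 hi hv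
    | succ i ih =>
      intro hi hv
      rw [h3 _ (by omega) hi, pV0, pV0, Nat.add_sub_cancel] at hv
      rw [sat_trig, sT_succ]
      exact ⟨hg' _ hi hv.1, hv.2.imp (hf' _ hi) (ih (by omega))⟩

lemma pV_min (v : PLTL AP → ℕ → ℕ → Prop) (φ : PLTL AP) {D : ℕ} (hD : φ.delta ≤ D) (d i : ℕ) :
    pV v φ (min d D) i = pV v φ d i := by
  unfold pV; rw [min_assoc, min_eq_right hD]

lemma sound_loop {k l p : ℕ} (hl : 0 < l) (hp : 0 < p) (hk : k + 1 = l + p)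
    {L : S → Set AP} {s : ℕ → S}
    {lsel inL : ℕ → Prop} {LE : Prop} (hLE : LE)
    (hsel : ∀ i, 1 ≤ i → i ≤ k → (lsel i ↔ i = l)) (hin : ∀ i, i ≤ k → (inL i ↔ l ≤ i))
    {v : PLTL AP → ℕ → ℕ → Prop} {vE vL : PLTL AP → ℕ → Prop} {aux : PLTL AP → ℕ → Prop}
    {auxE : PLTL AP → Prop} {φ : PLTL AP}
    (h : pincC true k L s lsel inL LE v vE vL aux auxE φ) :
    ∀ N, pV v φ (dd l p N) (ii l p N) ↔ PLTL.sat L (fun N => s (ii l p N)) φ N := by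
  have hik : ∀ N, ii l p N ≤ k := fun N => by have := ii_lt (l := l) hp N; omega
  have nxt : ∀ φ : PLTL AP, incLastC true k lsel LE v vE vL φ → ∀ N,
      (pV v φ (dd l p N) (ii l p N + 1) ↔ pV v φ (dd l p (N + 1)) (ii l p (N + 1))) := by
    intro φ hφ N
    rcases dd_ii_step (l := l) hp N with ⟨q1, q2, q3⟩ | ⟨q1, q2, q3⟩
    · rw [q2, q3]
    · rw [q2, q3, show ii l p N + 1 = k + 1 by omega]
      unfold pV
      obtain ⟨-, -, -, r⟩ := hφ (min (dd l p N) φ.delta) (min_le_right _ _)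
      rw [r rfl, pW, show min (min (dd l p N) φ.delta + 1) φ.delta
        = min (dd l p N + 1) φ.delta by omega]
      exact (hφ _ (min_le_right _ _)).2.1 l hl (by omega) ((hsel l hl (by omega)).2 rfl)
  have h00 := dd_ii_pre (l := l) (p := p) 0 hl
  -- general past step
  have past : ∀ φ : PLTL AP, incLastC true k lsel LE v vE vL φ → ∀ N,
      (dd l p (N + 1) = 0 ∧ ii l p (N + 1) - 1 = ii l p N ∧ dd l p N = 0 ∧ 1 ≤ ii l p (N + 1)) ∨
      (1 ≤ dd l p (N + 1) ∧ 1 ≤ ii l p (N + 1) ∧ ∀ D, φ.delta ≤ D →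
        (((lsel (ii l p (N + 1)) ∧ pW vE φ (min (dd l p (N + 1)) (D + 1) - 1)) ∨
          (¬ lsel (ii l p (N + 1)) ∧ pV v φ (min (dd l p (N + 1)) D) (ii l p (N + 1) - 1))) ↔
          pV v φ (dd l p N) (ii l p N))) := by
    intro φ hφ N
    have hl1 := lt_or_le_ii (l := l) (p := p) N
    rcases dd_ii_step (l := l) hp N with ⟨q1, q2, q3⟩ | ⟨q1, q2, q3⟩
    · rw [q2, q3]
      by_cases hd : dd l p N = 0
      · left; omega
      · right
        refine ⟨by omega, by omega, fun D hD => ?_⟩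
        rw [hsel _ (by omega) (by omega)]
        have : ii l p N + 1 ≠ l := by omega
        simp only [this, false_and, false_or, not_false_eq_true, true_and, Nat.add_sub_cancel]
        rw [pV_min _ _ hD]
    · right
      rw [q2, q3]
      refine ⟨by omega, hl, fun D hD => ?_⟩
      rw [hsel _ hl (by omega), show ii l p N = k by omega]
      simp only [true_and, not_true_eq_false, false_and, or_false]
      unfold pW pV
      rw [show min (min (dd l p N + 1) (D + 1) - 1) φ.delta = min (dd l p N) φ.delta by omega]
      exact (hφ _ (min_le_right _ _)).2.2.1 rfl
  have stab : ∀ φ : PLTL AP, (∀ N, dd l p N ≤ φ.delta →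
      (pV v φ (dd l p N) (ii l p N) ↔ PLTL.sat L (fun N => s (ii l p N)) φ N)) →
      ∀ N, (pV v φ (dd l p N) (ii l p N) ↔ PLTL.sat L (fun N => s (ii l p N)) φ N) := by
    intro φ hφ N
    by_cases hN : dd l p N ≤ φ.delta
    · exact hφ N hN
    · have hle : l ≤ ii l p N := by
        rcases lt_or_le_ii (l := l) (p := p) N with q | q
        · omega
        · exact q
      have hper : ∀ i, l ≤ i → (fun N => s (ii l p N)) (i + p) = (fun N => s (ii l p N)) i := by
        intro i hi
        have e := dd_ii l p i
        have hli : l ≤ ii l p i := by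
          rcases lt_or_le_ii (l := l) (p := p) i with q | q
          · omega
          · exact q
        have := (dd_ii_loop (l := l) (p := p) (ii l p i) (dd l p i + 1) hli (ii_lt hp i)).2
        dsimp only
        rw [show i + p = ii l p i + (dd l p i + 1) * p by rw [add_mul, one_mul]; omega, this]
      have hst := sat_stab L (π := fun N => s (ii l p N)) hp hper φ (ii l p N) hle (dd l p N)
      rw [← dd_ii l p N, min_eq_right (by omega)] at hst
      obtain ⟨e1, e2⟩ := dd_ii_loop (l := l) (p := p) (ii l p N) φ.delta hle (ii_lt hp N)
      have := hφ (ii l p N + φ.delta * p) (by omega)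
      rw [e1, e2] at this
      rw [← hst, ← this]
      unfold pV
      rw [min_eq_right (by omega), min_self]
  have hlast := pinc_last h
  induction φ with
  | atom a =>
    intro N
    have := h.1 _ (hik N)
    simpa [pV, PLTL.delta, PLTL.sat] using this
  | natom a =>
    intro N
    have := h.1 _ (hik N)
    simpa [pV, PLTL.delta, PLTL.sat] using this
  | conj f g hf hg =>
    obtain ⟨h1, h2, h3, -⟩ := h
    have hfd : f.delta ≤ (PLTL.conj f g).delta := le_max_left _ _
    have hgd : g.delta ≤ (PLTL.conj f g).delta := le_max_right _ _
    intro N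
    rw [PLTL.sat, ← hf h1 (pinc_last h1), ← hg h2 (pinc_last h2), pV,
      h3 _ (min_le_right _ _) _ (hik N), pV_min v f hfd, pV_min v g hgd]
  | disj f g hf hg =>
    obtain ⟨h1, h2, h3, -⟩ := h
    have hfd : f.delta ≤ (PLTL.disj f g).delta := le_max_left _ _
    have hgd : g.delta ≤ (PLTL.disj f g).delta := le_max_right _ _
    intro N
    rw [PLTL.sat, ← hf h1 (pinc_last h1), ← hg h2 (pinc_last h2), pV,
      h3 _ (min_le_right _ _) _ (hik N), pV_min v f hfd, pV_min v g hgd]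
  | next f hf =>
    obtain ⟨h1, h3, -⟩ := h
    have hfd : f.delta ≤ (PLTL.next f).delta := le_rfl
    intro N
    rw [sat_next, ← hf h1 (pinc_last h1), pV,
      h3 _ (min_le_right _ _) _ (hik N), pV_min v f hfd, nxt f (pinc_last h1)]
  | untl f g hf hg =>
    obtain ⟨h1, h2, h3, -, h5, h6, h7, h8⟩ := h
    have hf' := hf h1 (pinc_last h1)
    have hg' := hg h2 (pinc_last h2)
    have hfd : f.delta ≤ (PLTL.untl f g).delta := le_max_left _ _
    have hgd : g.delta ≤ (PLTL.untl f g).delta := le_max_right _ _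
    apply U_char
    · intro N
      rw [← hf', ← hg', ← nxt _ hlast N, pV, h3 _ (min_le_right _ _) _ (hik N),
        pV_min v f hfd, pV_min v g hgd]
      rfl
    · intro N
      by_cases hu : v (.untl f g) (PLTL.untl f g).delta k
      · have hE := h7 hLE (((hlast _ le_rfl).2.2.1 rfl).2 hu)
        rw [h8 rfl] at hE
        have : ∀ n, n ≤ k → aux (.untl f g) n → ∃ m, l ≤ m ∧ m ≤ n ∧ v g g.delta m := by
          intro n
          induction n with
          | zero => intro _ q; exact absurd q h5
          | succ n ih =>
            intro hn q
            rw [h6 _ (by omega) hn, Nat.add_sub_cancel] at q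
            rcases q with q | q
            · obtain ⟨m, a, b, c⟩ := ih (by omega) q
              exact ⟨m, a, by omega, c⟩
            · exact ⟨n + 1, (hin _ hn).1 q.1, le_rfl, q.2⟩
        obtain ⟨m, a, b, c⟩ := this k le_rfl hE
        refine ⟨m + (N + g.delta) * p, ?_, Or.inr ?_⟩
        · have := Nat.le_mul_of_pos_right (N + g.delta) hp
          omega
        · obtain ⟨e1, e2⟩ := dd_ii_loop (l := l) (p := p) m (N + g.delta) a (by omega)
          rw [← hg', e1, e2, pV, min_eq_right (by omega)]
          exact c
      · refine ⟨k + (N + (PLTL.untl f g).delta) * p, ?_, Or.inl ?_⟩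
        · have := Nat.le_mul_of_pos_right (N + (PLTL.untl f g).delta) hp
          omega
        · obtain ⟨e1, e2⟩ := dd_ii_loop (l := l) (p := p) k (N + (PLTL.untl f g).delta)
            (by omega) (by omega)
          rw [e1, e2, pV, min_eq_right (by omega)]
          exact hu
  | rels f g hf hg =>
    obtain ⟨h1, h2, h3, -, h5, h6, h7, h8⟩ := h
    have hf' := hf h1 (pinc_last h1)
    have hg' := hg h2 (pinc_last h2)
    have hfd : f.delta ≤ (PLTL.rels f g).delta := le_max_left _ _
    have hgd : g.delta ≤ (PLTL.rels f g).delta := le_max_right _ _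
    apply R_char
    · intro N
      rw [← hf', ← hg', ← nxt _ hlast N, pV, h3 _ (min_le_right _ _) _ (hik N),
        pV_min v f hfd, pV_min v g hgd]
      rfl
    · intro N
      by_cases hu : v (.rels f g) (PLTL.rels f g).delta k
      · refine ⟨k + (N + (PLTL.rels f g).delta) * p, ?_, Or.inl ?_⟩
        · have := Nat.le_mul_of_pos_right (N + (PLTL.rels f g).delta) hp
          omega
        · obtain ⟨e1, e2⟩ := dd_ii_loop (l := l) (p := p) k (N + (PLTL.rels f g).delta)
            (by omega) (by omega)
          rw [e1, e2, pV, min_eq_right (by omega)]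
          exact hu
      · have hE : ¬ aux (.rels f g) k := by
          intro q
          exact hu (((hlast _ le_rfl).2.2.1 rfl).1 (h7 hLE ((h8 rfl).2 q)))
        have : ∀ n, n ≤ k → ¬ aux (.rels f g) n → ∃ m, l ≤ m ∧ m ≤ n ∧ ¬ v g g.delta m := by
          intro n
          induction n with
          | zero => intro _ q; exact absurd h5 q
          | succ n ih =>
            intro hn q
            rw [h6 _ (by omega) hn, Nat.add_sub_cancel] at q
            by_cases q1 : aux (.rels f g) n
            · refine ⟨n + 1, ?_, le_rfl, fun q2 => q ⟨q1, Or.inr q2⟩⟩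
              rw [← hin _ hn]
              by_contra q3
              exact q ⟨q1, Or.inl q3⟩
            · obtain ⟨m, a, b, c⟩ := ih (by omega) q1
              exact ⟨m, a, by omega, c⟩
        obtain ⟨m, a, b, c⟩ := this k le_rfl hE
        refine ⟨m + (N + g.delta) * p, ?_, Or.inr ?_⟩
        · have := Nat.le_mul_of_pos_right (N + g.delta) hp
          omega
        · obtain ⟨e1, e2⟩ := dd_ii_loop (l := l) (p := p) m (N + g.delta) a (by omega)
          rw [← hg', e1, e2, pV, min_eq_right (by omega)]
          exact c
  | prev f hf =>
    obtain ⟨h1, h2, h3, h4, -⟩ := h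
    have hf' := hf h1 (pinc_last h1)
    intro N
    cases N with
    | zero =>
      rw [h00.1, h00.2, pV0]
      exact iff_of_false (h2 0 (Nat.zero_le _)) (sat_prev_zero _ _ _)
    | succ N =>
      rw [sat_prev_succ, ← hf']
      rcases past f (pinc_last h1) N with ⟨a, b, c, e⟩ | ⟨a, b, c⟩
      · rw [a, c, pV0, h3 _ e (hik _), b]
      · have hD : (PLTL.prev f).delta = f.delta + 1 := rfl
        rw [← c (f.delta + 1) (by omega), pV, hD,
          h4 _ (by omega) (by omega) _ b (hik _), pV_min v f (D := f.delta + 1) (by omega)]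
        rw [show min (dd l p (N + 1)) (f.delta + 1 + 1) - 1 = min (dd l p (N + 1) - 1) (f.delta + 1)
          by omega, show min (dd l p (N + 1)) (f.delta + 1) - 1 = min (dd l p (N + 1) - 1) f.delta
          by omega]
        unfold pW
        rw [min_assoc, min_assoc, min_self, min_eq_right (show f.delta ≤ f.delta + 1 by omega)]
  | wprev f hf =>
    obtain ⟨h1, h2, h3, h4, -⟩ := h
    have hf' := hf h1 (pinc_last h1)
    intro N
    cases N with
    | zero =>
      rw [h00.1, h00.2, pV0]
      exact iff_of_true (h2 0 (Nat.zero_le _)) (sat_wprev_zero _ _ _)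
    | succ N =>
      rw [sat_wprev_succ, ← hf']
      rcases past f (pinc_last h1) N with ⟨a, b, c, e⟩ | ⟨a, b, c⟩
      · rw [a, c, pV0, h3 _ e (hik _), b]
      · have hD : (PLTL.wprev f).delta = f.delta + 1 := rfl
        rw [← c (f.delta + 1) (by omega), pV, hD,
          h4 _ (by omega) (by omega) _ b (hik _), pV_min v f (D := f.delta + 1) (by omega)]
        rw [show min (dd l p (N + 1)) (f.delta + 1 + 1) - 1 = min (dd l p (N + 1) - 1) (f.delta + 1)
          by omega, show min (dd l p (N + 1)) (f.delta + 1) - 1 = min (dd l p (N + 1) - 1) f.delta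
          by omega]
        unfold pW
        rw [min_assoc, min_assoc, min_self, min_eq_right (show f.delta ≤ f.delta + 1 by omega)]
  | since f g hf hg =>
    obtain ⟨h0, h1, h2, h3, h4, -⟩ := h
    have hf' := hf h0 (pinc_last h0)
    have hg' := hg h1 (pinc_last h1)
    apply stab
    intro N
    induction N with
    | zero =>
      intro _
      rw [sat_since, sS_zero, ← hg', h00.1, h00.2, pV0, pV0, h2 0 (Nat.zero_le _), pV0]
    | succ N ih =>
      intro hN
      have hmono : dd l p N ≤ dd l p (N + 1) := by
        rcases dd_ii_step (l := l) hp N with ⟨q1, q2, q3⟩ | ⟨q1, q2, q3⟩ <;> omega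
      have ih' := ih (by omega)
      rw [sat_since] at ih'
      rw [sat_since, sS_succ, ← hf', ← hg', ← ih']
      rcases past _ hlast N with ⟨a, b, c, e⟩ | ⟨a, b, c⟩
      · rw [a, c, pV0, pV0 v (.since f g), h3 _ e (hik _), b]
      · have c' := c _ le_rfl
        rw [min_eq_left hN, min_eq_left (by omega), pW, min_eq_left (by omega)] at c'
        have e : ∀ j, pV v (.since f g) (dd l p (N + 1)) j = v (.since f g) (dd l p (N + 1)) j := by
          intro j; unfold pV; rw [min_eq_left hN]
        rw [e] at c'
        rw [← c', e, h4 _ a hN _ b (hik _)]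
  | trig f g hf hg =>
    obtain ⟨h0, h1, h2, h3, h4, -⟩ := h
    have hf' := hf h0 (pinc_last h0)
    have hg' := hg h1 (pinc_last h1)
    apply stab
    intro N
    induction N with
    | zero =>
      intro _
      rw [sat_trig, sT_zero, ← hg', h00.1, h00.2, pV0, pV0, h2 0 (Nat.zero_le _), pV0]
    | succ N ih =>
      intro hN
      have hmono : dd l p N ≤ dd l p (N + 1) := by
        rcases dd_ii_step (l := l) hp N with ⟨q1, q2, q3⟩ | ⟨q1, q2, q3⟩ <;> omega
      have ih' := ih (by omega)
      rw [sat_trig] at ih'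
      rw [sat_trig, sT_succ, ← hf', ← hg', ← ih']
      rcases past _ hlast N with ⟨a, b, c, e⟩ | ⟨a, b, c⟩
      · rw [a, c, pV0, pV0 v (.trig f g), h3 _ e (hik _), b]
      · have c' := c _ le_rfl
        rw [min_eq_left hN, min_eq_left (by omega), pW, min_eq_left (by omega)] at c'
        have e : ∀ j, pV v (.trig f g) (dd l p (N + 1)) j = v (.trig f g) (dd l p (N + 1)) j := by
          intro j; unfold pV; rw [min_eq_left hN]
        rw [e] at c'
        rw [← c', e, h4 _ a hN _ b (hik _)]

end BMC
namespace BMC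

variable {AP S : Type}

lemma IncSat_sound {M : Kripke S AP} (hTot : M.Total) {χ : PLTL AP} {k : ℕ}
    (h : IncSat M χ k) : ∃ π, M.InitPath π ∧ PLTL.sat M.L π χ 0 := by
  classical
  obtain ⟨s, sE, lsel, inL, LE, v, vE, vL, aux, auxE, hM, hL, hP, h0⟩ := h
  by_cases hLE : LE
  · obtain ⟨-, i0, a1, a2, a3, a4, a5⟩ := hL
    have a4 := a4 rfl
    have a5 := a5 rfl
    have hk := a4.1 hLE
    have hex : ∃ i, inL i := ⟨k, hk⟩
    obtain ⟨l, hl1, hl2⟩ : ∃ l, inL l ∧ ∀ m, m < l → ¬ inL m :=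
      ⟨Nat.find hex, Nat.find_spec hex, fun m hm => Nat.find_min hex hm⟩
    have hl0 : 0 < l := by
      rcases Nat.eq_zero_or_pos l with q | q
      · subst q; exact absurd hl1 i0
      · exact q
    have hlk : l ≤ k := by
      by_contra q
      exact hl2 k (by omega) hk
    have hin : ∀ i, i ≤ k → (inL i ↔ l ≤ i) := by
      intro i hi
      refine ⟨fun q => ?_, fun q => ?_⟩
      · by_contra q2
        exact hl2 i (by omega) q
      · induction i, q using Nat.le_induction with
        | base => exact hl1
        | succ n hn ih =>
          exact (a2 (n + 1) (by omega) hi).2 (Or.inl (ih (by omega)))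
    have hsel : ∀ i, 1 ≤ i → i ≤ k → (lsel i ↔ i = l) := by
      intro i hi hik
      refine ⟨fun q => ?_, fun q => ?_⟩
      · have q1 := (hin i hik).1 ((a2 i hi hik).2 (Or.inr q))
        by_contra q2
        exact a3 i hi hik ((hin (i - 1) (by omega)).2 (by omega)) q
      · subst q
        rcases (a2 i hi hik).1 hl1 with q | q
        · exact absurd q (hl2 _ (by omega))
        · exact q
    obtain ⟨p, hp⟩ : ∃ p, k + 1 = l + p := ⟨k + 1 - l, by omega⟩
    have hp0 : 0 < p := by omega
    have hss : s (l - 1) = s k := by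
      rw [a1 l hl0 hlk ((hsel l hl0 hlk).2 rfl), a5]
    have h00 := dd_ii_pre (l := l) (p := p) 0 hl0
    refine ⟨fun N => s (ii l p N), ⟨?_, fun N => ?_⟩, ?_⟩
    · dsimp only
      rw [h00.2]; exact hM.1
    · dsimp only
      have hlt := ii_lt (l := l) hp0 (N + 1)
      rcases dd_ii_step (l := l) hp0 N with ⟨q1, q2, q3⟩ | ⟨q1, q2, q3⟩
      · have := hM.2 (ii l p N + 1) (by omega) (by omega)
        rw [Nat.add_sub_cancel] at this
        simpa only [q2, q3] using this
      · have := hM.2 l hl0 hlk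
        rw [hss] at this
        have e : ii l p N = k := by omega
        simpa only [q2, q3, e] using this
    · rw [← sound_loop hl0 hp0 hp hLE hsel hin hP 0, h00.1, h00.2, pV0]
      exact h0
  · obtain ⟨π, hπ, hs⟩ := extend_path hTot hM
    exact ⟨π, hπ, sound_noloop hs hLE hP 0 (Nat.zero_le _) h0⟩

lemma exists_not_Compl [Finite S] (M : Kripke S AP) (χ : PLTL AP) :
    ∃ k, ¬ ComplSPSat M χ k := by
  classical
  have hF : Finite {φ // φ ∈ χ.subfs} := (List.finite_toSet χ.subfs).to_subtype
  let T := S × Prop × ((φ : {φ // φ ∈ χ.subfs}) → Fin (φ.1.delta + 1) → Prop) ×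
    ({φ // φ ∈ χ.subfs} → Prop)
  have hT : Finite T := inferInstance
  refine ⟨Nat.card T, ?_⟩
  rintro ⟨s, sE, lsel, inL, LE, v, vE, vL, aux, auxE, -, -, -, -, hS⟩
  let F : Fin (Nat.card T + 1) → T := fun i =>
    (s i, inL i, fun φ d => v φ.1 d i, fun φ => aux φ.1 i)
  have hni : ¬ Function.Injective F := by
    intro hi
    have := Nat.card_le_card_of_injective F hi
    simp at this
  have key : ∀ a b : Fin (Nat.card T + 1), a < b → F a ≠ F b := by
    intro a b hab e
    have e1 : s a = s b := congrArg (fun t : T => t.1) e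
    have e2 : inL a = inL b := congrArg (fun t : T => t.2.1) e
    have e3 : ∀ φ (_ : φ ∈ χ.subfs) d, d ≤ φ.delta → v φ d a = v φ d b := fun φ hφ d hd =>
      congrArg (fun t : T => t.2.2.1 ⟨φ, hφ⟩ ⟨d, Nat.lt_succ_of_le hd⟩) e
    have e4 : ∀ φ (_ : φ ∈ χ.subfs), aux φ a = aux φ b := fun φ hφ =>
      congrArg (fun t : T => t.2.2.2 ⟨φ, hφ⟩) e
    rcases hS a b hab (by omega) with q | q | ⟨φ, hφ, q⟩ | ⟨-, -, ⟨φ, hφ, d, hd, q⟩ | ⟨φ, hφ, -, q⟩⟩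
    · exact q e1
    · exact q (by rw [e2])
    · exact q (by rw [e3 φ hφ 0 (Nat.zero_le _)])
    · exact q (by rw [e3 φ hφ d hd])
    · exact q (by rw [e4 φ hφ])
  apply hni
  intro a b e
  rcases lt_trichotomy a b with q | q | q
  · exact absurd e (key a b q)
  · exact q
  · exact absurd e.symm (key b a q)

end BMC
open BMC in
/-- Theorem (completeness with larger increments): `M ⊨ ψ` iff for some
`k ≥ 0` the formula `⟦⟦M,¬ψ,k⟧⟧ ∧ ⟦SimplePath⟧_k` is unsatisfiable and
either `k = 0` or `⟦M,¬ψ,k-1⟧` is unsatisfiable. -/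
theorem bmc_completeness_incmore {S AP : Type} [Finite S]
    (M : Kripke S AP) (hTot : M.Total) (ψ : PLTL AP) :
    M.Models ψ ↔
    ∃ k : ℕ, ¬ ComplSPSat M ψ.neg k ∧ (k = 0 ∨ ¬ IncSat M ψ.neg (k - 1)) := by
  classical
  constructor
  · intro h
    obtain ⟨k, hk⟩ := exists_not_Compl M ψ.neg
    refine ⟨k, hk, Or.inr fun hI => ?_⟩
    obtain ⟨π, hπ, hs⟩ := IncSat_sound hTot hI
    exact (sat_neg M.L π ψ 0).1 hs (h π hπ)
  · rintro ⟨k, hk, hk2⟩ π hπ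
    by_contra hn
    have hex := LW_exists hπ ((sat_neg M.L π ψ 0).2 hn)
    by_cases hle : k ≤ Nat.find hex
    · exact hk (LW_min_Compl (Nat.find_spec hex) (fun m hm => Nat.find_min hex hm) hle)
    · rcases hk2 with q | q
      · omega
      · exact q (LW_IncSat (LW_mono (by omega) (Nat.find_spec hex)))
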